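/- Let Γ_1 ⊂ P^n be a generic set of α points in a hyperplane of P^n and Γ_2 ⊂ P^n a set of β distinct points on a line not contained in that hyperplane, with α ≥ β + n − 2, and let Γ = Γ_1 ∪ Γ_2. Then: (1) if α < C(β+n−3, n−1), then d(Γ) > A_n; (2) if α ≥ C(β+n, n−1), then d(Γ) = A_n. -/

import Mathlib

open MvPolynomial

noncomputable section

namespace PointsMinDist

variable {K : Type} [Field K]

/-- The (homogeneous) vanishing ideal of a set of points of projective space:
all polynomials vanishing at every representative vector of every point. -/
def vanishingIdeal {m : ℕ} (Γ : Set (Projectivization K (Fin m → K))) :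
    Ideal (MvPolynomial (Fin m) K) where
  carrier := {f | ∀ P ∈ Γ, ∀ (v : Fin m → K) (hv : v ≠ 0),
      Projectivization.mk K v hv = P → MvPolynomial.eval v f = 0}
  zero_mem' := by intro P hP v hv h; simp
  add_mem' := by
    intro f g hf hg P hP v hv h
    simp [hf P hP v hv h, hg P hP v hv h]
  smul_mem' := by
    intro c f hf P hP v hv h
    simp [smul_eq_mul, hf P hP v hv h]

/-- The degree-`d` graded component of a (homogeneous) ideal, as a `K`-subspace. -/
def degPart {m : ℕ} (I : Ideal (MvPolynomial (Fin m) K)) (d : ℕ) :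
    Submodule K (MvPolynomial (Fin m) K) :=
  Submodule.restrictScalars K I ⊓ homogeneousSubmodule (Fin m) K d

/-- `K`-dimension of the degree-`d` component of an ideal. -/
def hdim {m : ℕ} (I : Ideal (MvPolynomial (Fin m) K)) (d : ℕ) : ℕ :=
  Module.finrank K (degPart I d)

/-- Hilbert function of `R/I` in degree `d`. -/
def HF {m : ℕ} (I : Ideal (MvPolynomial (Fin m) K)) (d : ℕ) : ℕ :=
  Module.finrank K (homogeneousSubmodule (Fin m) K d) - hdim I d

open Classical in
/-- `hyp Γ`: the maximum number of points of `Γ` contained in a hyperplane. -/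
def hyp {m : ℕ} (Γ : Finset (Projectivization K (Fin m → K))) : ℕ :=
  sSup {k | ∃ φ : Module.Dual K (Fin m → K), φ ≠ 0 ∧
    k = (Γ.filter fun P => φ P.rep = 0).card}

/-- the minimum distance `d(Γ) = |Γ| - hyp(Γ)`. -/
def minDist {m : ℕ} (Γ : Finset (Projectivization K (Fin m → K))) : ℕ :=
  Γ.card - hyp Γ

/-- `Γ` is non-degenerate: it is not contained in any hyperplane. -/
def Nondeg {m : ℕ} (Γ : Finset (Projectivization K (Fin m → K))) : Prop :=
  ∀ φ : Module.Dual K (Fin m → K), (∀ P ∈ Γ, φ P.rep = 0) → φ = 0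

/-- The higher minimum distance `d(Γ)ₐ = |Γ| - max{|Γ'| : Γ' ⊆ Γ, dim I(Γ')ₐ > dim I(Γ)ₐ}`. -/
def higherD {m : ℕ} (Γ : Finset (Projectivization K (Fin m → K))) (a : ℕ) : ℕ :=
  Γ.card - sSup {k | ∃ Γ' ⊆ Γ,
    hdim (vanishingIdeal (Γ' : Set (Projectivization K (Fin m → K)))) a >
      hdim (vanishingIdeal (Γ : Set (Projectivization K (Fin m → K)))) a ∧ k = Γ'.card}

open Classical in
/-- The degree `δ(P)` of a point `P` in `Γ`: the least degree in which the ideal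
of `Γ \ {P}` is strictly bigger than the ideal of `Γ`. -/
def pointDegree {m : ℕ} (Γ : Finset (Projectivization K (Fin m → K)))
    (P : Projectivization K (Fin m → K)) : ℕ :=
  sInf {d | hdim (vanishingIdeal ((Γ.erase P) : Set (Projectivization K (Fin m → K)))) d >
    hdim (vanishingIdeal (Γ : Set (Projectivization K (Fin m → K)))) d}

/-- A graded minimal free resolution
`0 → F_len → ⋯ → F_1 → R → R/I → 0` of `R/I`, `R = K[x_0,…,x_{N-1}]`.
`F_j = ⊕_{i : Fin (rk j)} R(-(twist j i))` for `1 ≤ j ≤ len`.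
The differential `F_1 → R` is given by `gen` (so that its image is `I`) and the
differential `F_{j+2} → F_{j+1}` is given (in matrix form, rows indexed by the
target) by `mat j`.  All entries are homogeneous of the appropriate degrees, and
minimality means all entries lie in the irrelevant maximal ideal
(zero constant coefficient). -/
structure MinFreeRes (N : ℕ) (K : Type) [Field K] (I : Ideal (MvPolynomial (Fin N) K)) where
  len : ℕ
  rk : ℕ → ℕ
  twist : (j : ℕ) → Fin (rk j) → ℕ
  gen : Fin (rk 1) → MvPolynomial (Fin N) K
  mat : (j : ℕ) → Matrix (Fin (rk (j + 1))) (Fin (rk (j + 2))) (MvPolynomial (Fin N) K)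
  rk_len_pos : 0 < rk len
  rk_eq_zero : ∀ j, len < j → rk j = 0
  gen_hom : ∀ i, (gen i).IsHomogeneous (twist 1 i)
  gen_min : ∀ i, constantCoeff (gen i) = 0
  gen_span : Ideal.span (Set.range gen) = I
  mat_hom : ∀ j i i', mat j i i' = 0 ∨
    ∃ d, (mat j i i').IsHomogeneous d ∧ d + twist (j + 1) i = twist (j + 2) i'
  mat_min : ∀ j i i', constantCoeff (mat j i i') = 0
  exact_one : ∀ v : Fin (rk 1) → MvPolynomial (Fin N) K,
    (∑ i, v i * gen i = 0) ↔ v ∈ LinearMap.range (mat 0).mulVecLin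
  exact_rest : ∀ j, LinearMap.ker (mat j).mulVecLin = LinearMap.range (mat (j + 1)).mulVecLin

/-- `a(Γ)`: the minimal twist `min_i {a_i}` occurring in the last module
`F_len = ⊕ R(-a_i)` of the minimal free resolution. -/
def MinFreeRes.aMin {N : ℕ} {K : Type} [Field K] {I : Ideal (MvPolynomial (Fin N) K)}
    (res : MinFreeRes N K I) : ℕ :=
  Finset.univ.inf'
    (Finset.univ_nonempty_iff.mpr (Fin.pos_iff_nonempty.mp res.rk_len_pos))
    (fun i => res.twist res.len i)

/-- The minimum socle degree `A_n = min_i {a_i - n}` (here `n = len`, the length of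
the resolution). -/
def MinFreeRes.A {N : ℕ} {K : Type} [Field K] {I : Ideal (MvPolynomial (Fin N) K)}
    (res : MinFreeRes N K I) : ℤ :=
  (res.aMin : ℤ) - res.len


/-- Embedding of points of `P^{m-1}` into the hyperplane `x_0 = 0` of `P^m`. -/
def embedPt {m : ℕ} (P : Projectivization K (Fin m → K)) :
    Projectivization K (Fin (m + 1) → K) :=
  Projectivization.mk K (Fin.cons 0 P.rep) (by
    intro h
    apply P.rep_nonzero
    funext i
    simpa using congrFun h i.succ)

/-- The point `[1, c, 1, …, 1]` of `P^n` (a point on a line avoiding `x_0 = 0`). -/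
def linePt (n : ℕ) (c : K) : Projectivization K (Fin (n + 1) → K) :=
  Projectivization.mk K (fun j => if (j : ℕ) = 1 then c else 1) (by
    intro h
    have h0 := congrFun h 0
    simp at h0)

open Classical in
/-- The set `Γ = Γ₁ ∪ Γ₂` of the Migliore construction: a set `Γ₀` of points of
`P^{n-1}` embedded into the hyperplane `x_0 = 0`, together with the points
`[1, u_i, 1, …, 1]` on a line. -/
def MigGamma {n : ℕ} (Γ₀ : Finset (Projectivization K (Fin n → K)))
    {β : ℕ} (u : Fin β → K) : Finset (Projectivization K (Fin (n + 1) → K)) :=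
  Γ₀.image embedPt ∪ Finset.univ.image (fun i => linePt n (u i))

/-- The ideal `I₁ = ⟨x_0, J⟩ ⊆ R = K[x_0, …, x_n]`, where
`J ⊆ S = K[x_1, …, x_n]` (vars of `S` indexed by `Fin n`, with `X i` of `S`
corresponding to `x_{i+1}` of `R`). -/
def I1 {n : ℕ} (J : Ideal (MvPolynomial (Fin n) K)) :
    Ideal (MvPolynomial (Fin (n + 1)) K) :=
  Ideal.span {X 0} ⊔ Ideal.map (rename (Fin.succ : Fin n → Fin (n + 1))) J

/-- The polynomial `∏_{i=1}^β (u_i x_0 - x_1)`. -/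
def prodPoly (n β : ℕ) (u : Fin β → K) : MvPolynomial (Fin (n + 1)) K :=
  ∏ i : Fin β, (C (u i) * X 0 - X 1)

/-- The ideal `I₂ = ⟨∏ (u_i x_0 - x_1), x_2 - x_0, …, x_n - x_0⟩` of the `β`
points `[1, u_i, 1, …, 1]` on a line. -/
def I2 (n β : ℕ) (u : Fin β → K) : Ideal (MvPolynomial (Fin (n + 1)) K) :=
  Ideal.span ({prodPoly n β u} ∪
    {f | ∃ j : Fin (n + 1), 2 ≤ (j : ℕ) ∧ f = X j - X 0})

/-- The sequence `x_0, x_1^t, x_2, …, x_n`. -/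
def ciList (K : Type) [Field K] (n t : ℕ) : List (MvPolynomial (Fin (n + 1)) K) :=
  X 0 :: X 1 ^ t :: ((List.finRange (n + 1)).drop 2).map X

/-- The complete intersection ideal `⟨x_0, x_1^t, x_2, …, x_n⟩`. -/
def CIdeal (K : Type) [Field K] (n t : ℕ) : Ideal (MvPolynomial (Fin (n + 1)) K) :=
  Ideal.span {f | f ∈ ciList K n t}

/-- The set `𝒜 = {x_0(x_2 - x_0), …, x_0(x_n - x_0), x_0·∏(u_i x_0 - x_1)}`. -/
def calA (n β : ℕ) (u : Fin β → K) : Set (MvPolynomial (Fin (n + 1)) K) :=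
  {f | ∃ j : Fin (n + 1), 2 ≤ (j : ℕ) ∧ f = X 0 * (X j - X 0)} ∪
    {X 0 * prodPoly n β u}


section Koszul

/-- Koszul sign. -/
def ksgn {N : ℕ} (j : Fin N) (S : Finset (Fin N)) : ℤ := (-1) ^ (S.filter (· < j)).card

lemma ksgn_insert {N : ℕ} (i j : Fin N) (S : Finset (Fin N)) (hi : i ∉ S) :
    ksgn j (insert i S) = (if i < j then -1 else 1) * ksgn j S := by
  unfold ksgn
  rw [Finset.filter_insert]
  split_ifs with h
  · rw [Finset.card_insert_of_notMem (by simp [hi]), pow_succ]; ring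
  · simp

lemma ksgn_erase_self {N : ℕ} (j : Fin N) (S : Finset (Fin N)) :
    ksgn j (S.erase j) = ksgn j S := by
  unfold ksgn
  congr 2
  ext k
  simp only [Finset.mem_filter, Finset.mem_erase]
  constructor
  · rintro ⟨⟨_, h⟩, h'⟩; exact ⟨h, h'⟩
  · rintro ⟨h, h'⟩; exact ⟨⟨h'.ne, h⟩, h'⟩

lemma ksgn_insert_self {N : ℕ} (j : Fin N) (S : Finset (Fin N)) :
    ksgn j (insert j S) = ksgn j S := by
  by_cases h : j ∈ S
  · rw [Finset.insert_eq_of_mem h]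
  · rw [ksgn_insert _ _ _ h]; simp

lemma ksgn_mul_self {N : ℕ} (j : Fin N) (S : Finset (Fin N)) : ksgn j S * ksgn j S = 1 := by
  unfold ksgn
  rw [← mul_pow]; simp

lemma ksgn_anti {N : ℕ} (i j : Fin N) (S : Finset (Fin N)) (hij : i ≠ j) (hi : i ∉ S)
    (hj : j ∉ S) :
    ksgn i S * ksgn j (insert i S) = - (ksgn j S * ksgn i (insert j S)) := by
  rw [ksgn_insert _ _ _ hi, ksgn_insert _ _ _ hj]
  rcases lt_or_gt_of_ne hij with h | h
  · simp [h, h.not_gt]; ring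
  · simp [h, h.not_gt]; ring

/-- Koszul differential. -/
def kd {N : ℕ} (ω : Finset (Fin N) → MvPolynomial (Fin N) K) (S : Finset (Fin N)) :
    MvPolynomial (Fin N) K :=
  ∑ j ∈ Sᶜ, ksgn j S • (X j * ω (insert j S))

/-- de Rham differential. -/
def kdel {N : ℕ} (ω : Finset (Fin N) → MvPolynomial (Fin N) K) (S : Finset (Fin N)) :
    MvPolynomial (Fin N) K :=
  ∑ j ∈ S, ksgn j S • pderiv j (ω (S.erase j))

lemma kd_kd [CharZero K] {N : ℕ} (ω : Finset (Fin N) → MvPolynomial (Fin N) K)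
    (S : Finset (Fin N)) : kd (kd ω) S = 0 := by
  have h1 : kd (kd ω) S = ∑ j ∈ Sᶜ, ∑ i ∈ Sᶜ, (if i = j then 0 else
      (ksgn j S * ksgn i (insert j S)) • (X j * X i * ω (insert i (insert j S)))) := by
    unfold kd
    refine Finset.sum_congr rfl fun j hj => ?_
    rw [Finset.mul_sum, Finset.smul_sum]
    have : (insert j S)ᶜ = Sᶜ.erase j := by ext; simp
    rw [this, ← Finset.add_sum_erase _ _ hj]
    simp only [if_true, zero_add]
    refine Finset.sum_congr rfl fun i hi => ?_
    rw [if_neg (Finset.ne_of_mem_erase hi), mul_smul, mul_smul_comm, mul_assoc]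
  have h2 : kd (kd ω) S = - kd (kd ω) S := by
    conv_lhs => rw [h1, Finset.sum_comm]
    rw [h1, ← Finset.sum_neg_distrib]
    refine Finset.sum_congr rfl fun j hj => ?_
    rw [← Finset.sum_neg_distrib]
    refine Finset.sum_congr rfl fun i hi => ?_
    by_cases h : i = j
    · subst h; simp
    · rw [if_neg h, if_neg (Ne.symm h), ksgn_anti i j S h (by simpa using hi) (by simpa using hj),
        neg_smul, Finset.insert_comm, mul_comm (X i)]
  exact self_eq_neg.mp h2

lemma kd_homotopy {N : ℕ} (ω : Finset (Fin N) → MvPolynomial (Fin N) K)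
    (S : Finset (Fin N)) :
    kd (kdel ω) S + kdel (kd ω) S = (∑ j, X j * pderiv j (ω S)) + S.card • ω S := by
  have h1 : kd (kdel ω) S = ∑ j ∈ Sᶜ, X j * pderiv j (ω S) + ∑ j ∈ Sᶜ, ∑ i ∈ S,
      (ksgn j S * ksgn i (insert j S)) • (X j * pderiv i (ω ((insert j S).erase i))) := by
    rw [← Finset.sum_add_distrib]
    unfold kd kdel
    refine Finset.sum_congr rfl fun j hj => ?_
    have hj' : j ∉ S := by simpa using hj
    rw [Finset.sum_insert hj', mul_add, smul_add, ksgn_insert_self, Finset.erase_insert hj',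
      mul_smul_comm, ← mul_smul, ksgn_mul_self, one_smul, Finset.mul_sum, Finset.smul_sum]
    congr 1
    refine Finset.sum_congr rfl fun i hi => ?_
    rw [mul_smul, mul_smul_comm]
  have h2 : kdel (kd ω) S = ∑ i ∈ S, X i * pderiv i (ω S) + S.card • ω S + ∑ i ∈ S, ∑ j ∈ Sᶜ,
      (ksgn i S * ksgn j (S.erase i)) • (X j * pderiv i (ω (insert j (S.erase i)))) := by
    rw [← Finset.sum_const, ← Finset.sum_add_distrib, ← Finset.sum_add_distrib]
    unfold kd kdel
    refine Finset.sum_congr rfl fun i hi => ?_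
    beta_reduce
    have : (S.erase i)ᶜ = insert i Sᶜ := by
      ext k; simp only [Finset.mem_compl, Finset.mem_erase, Finset.mem_insert]; tauto
    rw [this, Finset.sum_insert (by simpa using hi), map_add, smul_add, map_zsmul, ← mul_smul,
      ksgn_erase_self, ksgn_mul_self, one_smul, Finset.insert_erase hi, map_sum, Finset.smul_sum]
    congr 1
    · rw [Derivation.leibniz]; simp [pderiv_X_self]
    · refine Finset.sum_congr rfl fun j hj => ?_
      have hij : j ≠ i := by rintro rfl; simp at hj; exact hj hi
      rw [map_zsmul, ← mul_smul, Derivation.leibniz, pderiv_X_of_ne hij]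
      simp
  rw [h1, h2, Finset.sum_comm (s := S)]
  have h3 : ∑ j ∈ Sᶜ, ∑ i ∈ S,
      (ksgn j S * ksgn i (insert j S)) • (X j * pderiv i (ω ((insert j S).erase i))) =
      - ∑ j ∈ Sᶜ, ∑ i ∈ S,
      (ksgn i S * ksgn j (S.erase i)) • (X j * pderiv i (ω (insert j (S.erase i)))) := by
    rw [← Finset.sum_neg_distrib]
    refine Finset.sum_congr rfl fun j hj => ?_
    rw [← Finset.sum_neg_distrib]
    refine Finset.sum_congr rfl fun i hi => ?_
    have hj' : j ∉ S := by simpa using hj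
    have hij : j ≠ i := by rintro rfl; exact hj' hi
    rw [Finset.erase_insert_of_ne hij, ← neg_smul]
    congr 1
    have h := ksgn_anti i j (S.erase i) hij.symm (by simp) (by simp [hj'])
    rw [Finset.insert_erase hi] at h
    have h4 : ksgn i (insert j S) = ksgn i (insert j (S.erase i)) := by
      rw [← Finset.erase_insert_of_ne hij, ksgn_erase_self]
    have h5 : ksgn i (S.erase i) = ksgn i S := ksgn_erase_self _ _
    rw [h4]
    rw [h5] at h
    have h6 : ksgn i (insert j (S.erase i)) = (if j < i then -1 else 1) * ksgn i S := by
      rw [ksgn_insert _ _ _ (by simp [hj']), h5]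
    have h7 : ksgn j S = (if i < j then -1 else 1) * ksgn j (S.erase i) := by
      conv_lhs => rw [← Finset.insert_erase hi]
      rw [ksgn_insert _ _ _ (by simp)]
    rw [h6, h7]
    rcases lt_or_gt_of_ne hij with h | h
    · simp [h, h.not_gt]; ring
    · simp [h, h.not_gt]; ring
  rw [h3, ← Finset.sum_add_sum_compl S]
  abel

end Koszul

section Graded

/-- `f` is homogeneous of degree `e - k` (zero if `e < k`). -/
def GH {N : ℕ} (f : MvPolynomial (Fin N) K) (k e : ℕ) : Prop :=
  f = 0 ∨ ∃ r, f.IsHomogeneous r ∧ r + k = e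

lemma GH.zero {N : ℕ} (k e : ℕ) : GH (0 : MvPolynomial (Fin N) K) k e := Or.inl rfl

lemma GH.add {N : ℕ} {f g : MvPolynomial (Fin N) K} {k e : ℕ} (hf : GH f k e) (hg : GH g k e) :
    GH (f + g) k e := by
  rcases hf with rfl | ⟨r, hr, h⟩
  · simpa using hg
  · rcases hg with rfl | ⟨r', hr', h'⟩
    · rw [add_zero]; exact Or.inr ⟨r, hr, h⟩
    · obtain rfl : r = r' := by omega
      exact Or.inr ⟨r, hr.add hr', h⟩

lemma GH.neg {N : ℕ} {f : MvPolynomial (Fin N) K} {k e : ℕ} (hf : GH f k e) :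
    GH (-f) k e := by
  rcases hf with rfl | ⟨r, hr, h⟩
  · simpa using GH.zero k e
  · exact Or.inr ⟨r, hr.neg, h⟩

lemma GH.sum {N : ℕ} {ι : Type*} (s : Finset ι) {f : ι → MvPolynomial (Fin N) K} {k e : ℕ}
    (hf : ∀ i ∈ s, GH (f i) k e) : GH (∑ i ∈ s, f i) k e := by
  classical
  induction s using Finset.induction_on with
  | empty => simpa using GH.zero k e
  | insert a s ha ih =>
    rw [Finset.sum_insert ha]
    exact (hf a (by simp)).add (ih fun i hi => hf i (by simp [hi]))

lemma GH.mul {N : ℕ} {f g : MvPolynomial (Fin N) K} {k d k' e : ℕ} (hf : f.IsHomogeneous d)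
    (hg : GH g k' e) (hk : d + k = k') : GH (f * g) k e := by
  rcases hg with rfl | ⟨r, hr, h⟩
  · simpa using GH.zero k e
  · exact Or.inr ⟨d + r, hf.mul hr, by omega⟩

lemma GH.C_mul {N : ℕ} {g : MvPolynomial (Fin N) K} {k e : ℕ} (c : K)
    (hg : GH g k e) : GH (C c * g) k e :=
  GH.mul (isHomogeneous_C _ c) hg (by omega)

lemma GH.zsmul {N : ℕ} {g : MvPolynomial (Fin N) K} {k e : ℕ} (c : ℤ)
    (hg : GH g k e) : GH (c • g) k e := by
  have : c • g = C (c : K) * g := by simp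
  rw [this]; exact hg.C_mul _

lemma GH.pderiv {N : ℕ} {g : MvPolynomial (Fin N) K} {k e : ℕ} (j : Fin N)
    (hg : GH g k e) : GH (MvPolynomial.pderiv j g) (k + 1) e := by
  rcases hg with rfl | ⟨r, hr, h⟩
  · simpa using GH.zero _ e
  · rcases r with _ | r
    · left
      rw [← totalDegree_zero_iff_isHomogeneous, totalDegree_eq_zero_iff_eq_C] at hr
      rw [hr, pderiv_C]
    · exact Or.inr ⟨r, by simpa using hr.pderiv (i := j), by omega⟩

/-- graded projection -/
def GP {N : ℕ} (k e : ℕ) (f : MvPolynomial (Fin N) K) : MvPolynomial (Fin N) K :=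
  if k ≤ e then homogeneousComponent (e - k) f else 0

lemma GP_GH {N : ℕ} (k e : ℕ) (f : MvPolynomial (Fin N) K) : GH (GP k e f) k e := by
  unfold GP
  split_ifs with h
  · exact Or.inr ⟨e - k, homogeneousComponent_isHomogeneous _ _, by omega⟩
  · exact GH.zero _ _

lemma GP_eq {N : ℕ} {k e : ℕ} {f : MvPolynomial (Fin N) K} (hf : GH f k e) : GP k e f = f := by
  unfold GP
  rcases hf with rfl | ⟨r, hr, h⟩
  · simp
  · rw [if_pos (by omega)]
    obtain rfl : e - k = r := by omega
    exact homogeneousComponent_eq_self hr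

lemma GP_sum {N : ℕ} {ι : Type*} (s : Finset ι) {f : ι → MvPolynomial (Fin N) K} {k e : ℕ} :
    GP k e (∑ i ∈ s, f i) = ∑ i ∈ s, GP k e (f i) := by
  unfold GP
  split_ifs
  · simp
  · simp

lemma homComp_mul_aux {N : ℕ} {f g : MvPolynomial (Fin N) K} {d : ℕ} (hf : f.IsHomogeneous d)
    (m : ℕ) : homogeneousComponent m (f * g) = ∑ j ∈ Finset.range (g.totalDegree + 1),
      if d + j = m then f * homogeneousComponent j g else 0 := by
  conv_lhs => rw [← sum_homogeneousComponent g, Finset.mul_sum, map_sum]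
  refine Finset.sum_congr rfl fun j _ => ?_
  rw [homogeneousComponent_of_mem (m := m) (n := d + j)
    (hf.mul (homogeneousComponent_isHomogeneous j g))]
  simp [eq_comm]

lemma homComp_mul_add {N : ℕ} {f g : MvPolynomial (Fin N) K} {d r : ℕ} (hf : f.IsHomogeneous d) :
    homogeneousComponent (d + r) (f * g) = f * homogeneousComponent r g := by
  rw [homComp_mul_aux hf]
  simp only [add_right_inj, Finset.sum_ite_eq', Finset.mem_range]
  split_ifs with h
  · rfl
  · rw [homogeneousComponent_eq_zero _ _ (by omega), mul_zero]

lemma homComp_mul_lt {N : ℕ} {f g : MvPolynomial (Fin N) K} {d m : ℕ} (hf : f.IsHomogeneous d)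
    (hm : m < d) : homogeneousComponent m (f * g) = 0 := by
  rw [homComp_mul_aux hf]
  refine Finset.sum_eq_zero fun j _ => ?_
  rw [if_neg (by omega)]

lemma GP_mul {N : ℕ} {f g : MvPolynomial (Fin N) K} {k k' e : ℕ}
    (hf : f = 0 ∨ ∃ d, f.IsHomogeneous d ∧ d + k = k') :
    GP k e (f * g) = f * GP k' e g := by
  rcases hf with rfl | ⟨d, hf, rfl⟩
  · simp [GP]
  · unfold GP
    by_cases h : d + k ≤ e
    · rw [if_pos h, if_pos (by omega), ← homComp_mul_add hf]
      congr 2; omega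
    · rw [if_neg h, mul_zero]
      split_ifs with h'
      · exact homComp_mul_lt hf (by omega)
      · rfl

lemma GH.eq_zero_of_eq {N : ℕ} {f : MvPolynomial (Fin N) K} {k : ℕ} (hf : GH f k k)
    (h0 : constantCoeff f = 0) : f = 0 := by
  rcases hf with h | ⟨r, hr, h⟩
  · exact h
  · obtain rfl : r = 0 := by omega
    rw [← totalDegree_zero_iff_isHomogeneous, totalDegree_eq_zero_iff_eq_C] at hr
    rw [hr]
    rw [constantCoeff_eq] at h0
    rw [h0, map_zero]

/-- The bigraded pieces. -/
def HH {N : ℕ} {ι : Type} (tw : ι → ℕ) (e p : ℕ) (ω : ι → Finset (Fin N) → MvPolynomial (Fin N) K) :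
    Prop :=
  ∀ i S, (S.card ≠ p → ω i S = 0) ∧ GH (ω i S) (S.card + tw i) e

variable {N : ℕ} {ι : Type} {tw : ι → ℕ} {e p : ℕ}

lemma HH.add {x y : ι → Finset (Fin N) → MvPolynomial (Fin N) K} (hx : HH tw e p x)
    (hy : HH tw e p y) : HH tw e p (x + y) := fun i S =>
  ⟨fun h => by simp [(hx i S).1 h, (hy i S).1 h], (hx i S).2.add (hy i S).2⟩

lemma HH.neg {x : ι → Finset (Fin N) → MvPolynomial (Fin N) K} (hx : HH tw e p x) :
    HH tw e p (-x) := fun i S =>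
  ⟨fun h => by simp [(hx i S).1 h], (hx i S).2.neg⟩

lemma HH.sub {x y : ι → Finset (Fin N) → MvPolynomial (Fin N) K} (hx : HH tw e p x)
    (hy : HH tw e p y) : HH tw e p (x - y) := by
  rw [sub_eq_add_neg]; exact hx.add hy.neg

/-- Koszul differential with coefficients in a free module. -/
def kD {N : ℕ} {ι : Type} (ω : ι → Finset (Fin N) → MvPolynomial (Fin N) K) :
    ι → Finset (Fin N) → MvPolynomial (Fin N) K := fun i => kd (ω i)

lemma kD_add (x y : ι → Finset (Fin N) → MvPolynomial (Fin N) K) : kD (x + y) = kD x + kD y := by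
  funext i S
  simp [kD, kd, mul_add, Finset.sum_add_distrib]

lemma kD_neg (x : ι → Finset (Fin N) → MvPolynomial (Fin N) K) : kD (-x) = - kD x := by
  funext i S
  simp [kD, kd]

lemma kD_sub (x y : ι → Finset (Fin N) → MvPolynomial (Fin N) K) : kD (x - y) = kD x - kD y := by
  rw [sub_eq_add_neg, kD_add, kD_neg, sub_eq_add_neg]

lemma kD_kD [CharZero K] (x : ι → Finset (Fin N) → MvPolynomial (Fin N) K) : kD (kD x) = 0 := by
  funext i S
  exact kd_kd (x i) S

lemma HH.kD {x : ι → Finset (Fin N) → MvPolynomial (Fin N) K} (hx : HH tw e (p + 1) x) :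
    HH tw e p (kD x) := by
  intro i S
  constructor
  · intro h
    refine Finset.sum_eq_zero fun j hj => ?_
    have hj' : j ∉ S := by simpa using hj
    rw [(hx i _).1 (by rw [Finset.card_insert_of_notMem hj']; omega)]
    simp
  · refine GH.sum _ fun j hj => GH.zsmul _ ?_
    have hj' : j ∉ S := by simpa using hj
    refine GH.mul (isHomogeneous_X _ j) (hx i _).2 ?_
    rw [Finset.card_insert_of_notMem hj']; omega

lemma kD_eq_zero_of_HH_zero {x : ι → Finset (Fin N) → MvPolynomial (Fin N) K} (hx : HH tw e 0 x) :
    kD x = 0 := by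
  funext i S
  refine Finset.sum_eq_zero fun j hj => ?_
  have hj' : j ∉ S := by simpa using hj
  rw [(hx i _).1 (by rw [Finset.card_insert_of_notMem hj']; omega)]
  simp

lemma kD_exact [CharZero K] {x : ι → Finset (Fin N) → MvPolynomial (Fin N) K} (hx : HH tw e p x)
    (h0 : kD x = 0) (hz : ∀ i S, tw i = e → x i S = 0) :
    ∃ y, HH tw e (p + 1) y ∧ kD y = x := by
  refine ⟨fun i S => C (((e : K) - tw i)⁻¹) * kdel (x i) S, ?_, ?_⟩
  · intro i S
    constructor
    · intro h
      have : kdel (x i) S = 0 := by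
        refine Finset.sum_eq_zero fun j hj => ?_
        rw [(hx i _).1 (by
          rw [Finset.card_erase_of_mem hj]
          have := Finset.card_pos.mpr ⟨j, hj⟩
          omega)]
        simp
      simp [this]
    · refine GH.C_mul _ (GH.sum _ fun j hj => GH.zsmul _ ?_)
      have h := (hx i (S.erase j)).2.pderiv j
      have h2 := Finset.card_erase_add_one hj
      have : (S.erase j).card + tw i + 1 = S.card + tw i := by omega
      rwa [this] at h
  · funext i S
    have h1 : kD (fun i S => C (((e : K) - tw i)⁻¹) * kdel (x i) S) i S =
        C (((e : K) - tw i)⁻¹) * kd (kdel (x i)) S := by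
      simp only [kD, kd, Finset.mul_sum]
      refine Finset.sum_congr rfl fun j hj => ?_
      simp only [zsmul_eq_mul]; ring
    have h2 := kd_homotopy (x i) S
    have h3 : kdel (kd (x i)) S = 0 := by
      have : kd (x i) = 0 := congrFun h0 i
      rw [this]; simp [kdel]
    rw [h3, add_zero] at h2
    rw [h1, h2]
    rcases (hx i S).2 with h | ⟨r, hr, h⟩
    · simp [h]
    · by_cases hte : tw i = e
      · simp [hz i S hte]
      · rw [hr.sum_X_mul_pderiv, ← add_nsmul]
        have h4 : (e : K) - tw i = ((r + S.card : ℕ) : K) := by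
          rw [← h]; push_cast; ring
        have h5 : ((r + S.card : ℕ) : K) ≠ 0 := by
          rw [Nat.cast_ne_zero]; omega
        rw [h4, nsmul_eq_mul, ← mul_assoc]
        have : ((r + S.card : ℕ) : MvPolynomial (Fin N) K) = C ((r + S.card : ℕ) : K) := by simp
        rw [this, ← C_mul, inv_mul_cancel₀ h5]; simp

lemma kD_exact_pos [CharZero K] {x : ι → Finset (Fin N) → MvPolynomial (Fin N) K}
    (hx : HH tw e (p + 1) x) (h0 : kD x = 0) :
    ∃ y, HH tw e (p + 2) y ∧ kD y = x := by
  refine kD_exact hx h0 fun i S h => ?_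
  by_cases hS : S.card = p + 1
  · rcases (hx i S).2 with h' | ⟨r, hr, h'⟩
    · exact h'
    · omega
  · exact (hx i S).1 hS

end Graded

section Complexes

/-- Graded complexes of free modules, exact in positive degrees, with minimality. -/
structure GCx (N : ℕ) (K : Type) [Field K] where
  ι : ℕ → Type
  ft : ∀ q, Fintype (ι q)
  tw : ∀ q, ι q → ℕ
  D : ∀ q, ι q → ι (q + 1) → MvPolynomial (Fin N) K
  hom : ∀ q i i', D q i i' = 0 ∨ ∃ d, (D q i i').IsHomogeneous d ∧ d + tw q i = tw (q + 1) i'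
  mini : ∀ q i i', constantCoeff (D q i i') = 0
  exact : ∀ q (y : ι (q + 1) → MvPolynomial (Fin N) K),
    (∀ i, ∑ i', D q i i' * y i' = 0) ↔ ∃ z : ι (q + 2) → MvPolynomial (Fin N) K,
      ∀ i, y i = ∑ i', D (q + 1) i i' * z i'

attribute [instance] GCx.ft

variable {N : ℕ} (F : GCx N K)

/-- Differential of the complex, with Koszul coefficients. -/
def GCx.dD {q : ℕ} (y : F.ι (q + 1) → Finset (Fin N) → MvPolynomial (Fin N) K) :
    F.ι q → Finset (Fin N) → MvPolynomial (Fin N) K :=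
  fun i S => ∑ i', F.D q i i' * y i' S

lemma GCx.dD_add {q : ℕ} (x y : F.ι (q + 1) → Finset (Fin N) → MvPolynomial (Fin N) K) :
    F.dD (x + y) = F.dD x + F.dD y := by
  funext i S
  simp [dD, mul_add, Finset.sum_add_distrib]

lemma GCx.dD_neg {q : ℕ} (x : F.ι (q + 1) → Finset (Fin N) → MvPolynomial (Fin N) K) :
    F.dD (-x) = - F.dD x := by
  funext i S
  simp [dD]

lemma GCx.dD_sub {q : ℕ} (x y : F.ι (q + 1) → Finset (Fin N) → MvPolynomial (Fin N) K) :
    F.dD (x - y) = F.dD x - F.dD y := by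
  rw [sub_eq_add_neg, dD_add, dD_neg, sub_eq_add_neg]

lemma GCx.dD_kD {q : ℕ} (x : F.ι (q + 1) → Finset (Fin N) → MvPolynomial (Fin N) K) :
    F.dD (kD x) = kD (F.dD x) := by
  funext i S
  simp only [dD, kD, kd, Finset.mul_sum, Finset.smul_sum]
  rw [Finset.sum_comm]
  refine Finset.sum_congr rfl fun j _ => Finset.sum_congr rfl fun k _ => ?_
  simp only [zsmul_eq_mul]; ring

lemma GCx.dD_dD {q : ℕ} (x : F.ι (q + 2) → Finset (Fin N) → MvPolynomial (Fin N) K) :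
    F.dD (F.dD x) = 0 := by
  funext i S
  exact (F.exact q (fun i => F.dD x i S)).mpr ⟨fun i => x i S, fun i => rfl⟩ i

variable {F} in
lemma HH.dD {q e p : ℕ} {x : F.ι (q + 1) → Finset (Fin N) → MvPolynomial (Fin N) K}
    (hx : HH (F.tw (q + 1)) e p x) : HH (F.tw q) e p (F.dD x) := by
  intro i S
  constructor
  · intro h
    refine Finset.sum_eq_zero fun j hj => ?_
    rw [(hx j S).1 h, mul_zero]
  · refine GH.sum _ fun j hj => ?_
    rcases F.hom q i j with h | ⟨d, hd, h⟩
    · rw [h, zero_mul]; exact GH.zero _ _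
    · exact GH.mul hd (hx j S).2 (by omega)

lemma GCx.dD_lift {q e p : ℕ} {x : F.ι q → Finset (Fin N) → MvPolynomial (Fin N) K}
    (hx : HH (F.tw q) e p x)
    (h : ∀ S, S.card = p → ∃ y : F.ι (q + 1) → MvPolynomial (Fin N) K,
      ∀ i, x i S = ∑ i', F.D q i i' * y i') :
    ∃ y, HH (F.tw (q + 1)) e p y ∧ F.dD y = x := by
  choose! y hy using h
  refine ⟨fun i S => if S.card = p then GP (S.card + F.tw (q + 1) i) e (y S i) else 0, ?_, ?_⟩
  · intro i S
    constructor
    · intro h; simp [h]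
    · dsimp only
      split_ifs
      · exact GP_GH _ _ _
      · exact GH.zero _ _
  · funext i S
    by_cases hS : S.card = p
    · have h1 := GP_eq (hx i S).2
      rw [← h1, hy S hS i, GP_sum]
      unfold dD
      refine Finset.sum_congr rfl fun j _ => ?_
      beta_reduce
      rw [if_pos hS]
      refine (GP_mul ?_).symm
      rcases F.hom q i j with h | ⟨d, hd, h⟩
      · exact Or.inl h
      · exact Or.inr ⟨d, hd, by omega⟩
    · rw [(hx i S).1 hS]
      simp [dD, hS]

lemma GCx.dD_exact {q e p : ℕ} {x : F.ι (q + 1) → Finset (Fin N) → MvPolynomial (Fin N) K}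
    (hx : HH (F.tw (q + 1)) e p x) (h : F.dD x = 0) :
    ∃ y, HH (F.tw (q + 2)) e p y ∧ F.dD y = x := by
  refine F.dD_lift hx fun S _ => (F.exact q (fun i => x i S)).mp fun i => ?_
  exact congrFun (congrFun h i) S

/-- Nontrivial class at spot `(p, q+1)`, first description. -/
def GCx.NN (e p q : ℕ) : Prop :=
  ∃ x, HH (F.tw (q + 1)) e p x ∧ (∃ z, HH (F.tw q) e (p + 1) z ∧ kD z = F.dD x) ∧
    ¬ ∃ a b, HH (F.tw (q + 2)) e p a ∧ HH (F.tw (q + 1)) e (p + 1) b ∧ x = F.dD a + kD b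

/-- Nontrivial class at spot `(p+1, q)`, second description. -/
def GCx.MM (e p q : ℕ) : Prop :=
  ∃ z, HH (F.tw q) e (p + 1) z ∧ (∃ x, HH (F.tw (q + 1)) e p x ∧ F.dD x = kD z) ∧
    ¬ ∃ a b, HH (F.tw (q + 1)) e (p + 1) a ∧ HH (F.tw q) e (p + 2) b ∧ z = F.dD a + kD b

lemma GCx.NN_iff_MM [CharZero K] (e p q : ℕ) : F.NN e p q ↔ F.MM e p q := by
  constructor
  · rintro ⟨x, hx, ⟨z, hz, hzx⟩, hn⟩
    refine ⟨z, hz, ⟨x, hx, hzx.symm⟩, ?_⟩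
    rintro ⟨a, b, ha, hb, rfl⟩
    apply hn
    rw [kD_add, kD_kD, add_zero, ← F.dD_kD] at hzx
    obtain ⟨c, hc, hc'⟩ := F.dD_exact (hx.sub ha.kD) (by rw [F.dD_sub, hzx, sub_self])
    exact ⟨c, a, hc, ha, by rw [hc']; abel⟩
  · rintro ⟨z, hz, ⟨x, hx, hzx⟩, hn⟩
    refine ⟨x, hx, ⟨z, hz, hzx.symm⟩, ?_⟩
    rintro ⟨a, b, ha, hb, rfl⟩
    apply hn
    rw [F.dD_add, F.dD_dD, zero_add, F.dD_kD] at hzx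
    obtain ⟨c, hc, hc'⟩ := kD_exact_pos (hz.sub hb.dD) (by rw [kD_sub, hzx, sub_self])
    exact ⟨b, c, hb, hc, by rw [hc']; abel⟩

lemma GCx.MM_iff_NN [CharZero K] (e p q : ℕ) : F.MM e p (q + 1) ↔ F.NN e (p + 1) q := by
  constructor
  · rintro ⟨z, hz, ⟨x, hx, hzx⟩, hn⟩
    refine ⟨z, hz, kD_exact_pos hz.dD ?_, hn⟩
    rw [← F.dD_kD, ← hzx, F.dD_dD]
  · rintro ⟨x, hx, ⟨z, hz, hzx⟩, hn⟩
    refine ⟨x, hx, F.dD_exact hx.kD ?_, hn⟩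
    rw [F.dD_kD, ← hzx, kD_kD]

lemma GCx.NN_iff_MM_zero [CharZero K] (e q p : ℕ) : F.NN e p q ↔ F.MM e (p + q) 0 := by
  induction q generalizing p with
  | zero => exact F.NN_iff_MM e p 0
  | succ q ih =>
    rw [F.NN_iff_MM, F.MM_iff_NN, ih]
    have : p + 1 + q = p + (q + 1) := by omega
    rw [this]

lemma GCx.NN_zero_iff [CharZero K] (e m : ℕ) (hE : IsEmpty (F.ι (m + 2))) :
    F.NN e 0 m ↔ ∃ i, F.tw (m + 1) i = e := by
  classical
  constructor
  · rintro ⟨x, hx, -, hn⟩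
    by_contra hne
    push Not at hne
    apply hn
    obtain ⟨y, hy, hyx⟩ := kD_exact hx (kD_eq_zero_of_HH_zero hx) (fun i S h => absurd h (hne i))
    refine ⟨0, y, fun i => hE.elim i, hy, ?_⟩
    rw [hyx]
    funext i S
    simp [dD]
  · rintro ⟨i, hi⟩
    have hx : HH (N := N) (K := K) (F.tw (m + 1)) e 0 (fun k S => if S = ∅ ∧ k = i then 1 else 0) := by
      intro k S
      constructor
      · intro h
        have : S ≠ ∅ := by rintro rfl; simp at h
        simp [this]
      · dsimp only
        split_ifs with h
        · refine Or.inr ⟨0, isHomogeneous_one _ _, ?_⟩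
          rw [h.1, h.2, hi]; simp
        · exact GH.zero _ _
    refine ⟨_, hx, kD_exact hx.dD (kD_eq_zero_of_HH_zero hx.dD) ?_, ?_⟩
    · intro k S hk
      by_cases hS : S = ∅
      · have h := (hx.dD k S).2
        subst hS
        rw [Finset.card_empty, zero_add, hk] at h
        refine h.eq_zero_of_eq ?_
        simp [dD, F.mini]
      · simp [dD, hS]
    · rintro ⟨a, b, -, -, h⟩
      have h1 := congrArg constantCoeff (congrFun (congrFun h i) ∅)
      simp [dD, kD, kd] at h1

end Complexes

section Socle

/-- Nontrivial socle-type families of degree `d`. -/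
def Soc {N : ℕ} (I : Ideal (MvPolynomial (Fin N) K)) (d : ℕ) : Prop :=
  ∃ g : Fin N → MvPolynomial (Fin N) K, (∀ j, (g j).IsHomogeneous d) ∧
    (∀ i j, X i * g j - X j * g i ∈ I) ∧
    ¬ ∃ h : MvPolynomial (Fin N) K, GH h 1 d ∧ ∀ j, g j - X j * h ∈ I

lemma kd_pair {N : ℕ} (z : Finset (Fin N) → MvPolynomial (Fin N) K) (i j : Fin N) (hij : i < j) :
    kd z ({i, j} : Finset (Fin N))ᶜ = (ksgn i Finset.univ * ksgn j Finset.univ) •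
      (X i * (ksgn j Finset.univ • z (Finset.univ.erase j)) -
        X j * (ksgn i Finset.univ • z (Finset.univ.erase i))) := by
  unfold kd
  rw [compl_compl, Finset.sum_pair hij.ne]
  have e1 : insert i ({i, j} : Finset (Fin N))ᶜ = Finset.univ.erase j := by
    ext k; simp only [Finset.mem_insert, Finset.mem_compl, Finset.mem_singleton, Finset.mem_erase,
      Finset.mem_univ, and_true]
    have := hij.ne
    constructor
    · rintro (rfl | h)
      · exact this
      · tauto
    · intro h; tauto
  have e2 : insert j ({i, j} : Finset (Fin N))ᶜ = Finset.univ.erase i := by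
    ext k; simp only [Finset.mem_insert, Finset.mem_compl, Finset.mem_singleton, Finset.mem_erase,
      Finset.mem_univ, and_true]
    have := hij.ne
    constructor
    · rintro (rfl | h)
      · exact this.symm
      · tauto
    · intro h; tauto
  have s1 : ksgn i Finset.univ = ksgn i ({i, j} : Finset (Fin N))ᶜ := by
    rw [← ksgn_erase_self, ← e2, ksgn_insert _ _ _ (by simp), if_neg hij.not_gt, one_mul]
  have s2 : ksgn j Finset.univ = - ksgn j ({i, j} : Finset (Fin N))ᶜ := by
    rw [← ksgn_erase_self, ← e1, ksgn_insert _ _ _ (by simp), if_pos hij]; ring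
  rw [e1, e2, ← s1]
  have s3 : ksgn j ({i, j} : Finset (Fin N))ᶜ = - ksgn j Finset.univ := by rw [s2, neg_neg]
  rw [s3]
  have h1 := ksgn_mul_self i (Finset.univ)
  have h2 := ksgn_mul_self j (Finset.univ)
  generalize ksgn i Finset.univ = a at *
  generalize ksgn j Finset.univ = b at *
  rw [smul_sub, mul_smul_comm, mul_smul_comm, smul_smul, smul_smul]
  have h3 : a * b * a = b := by rw [mul_comm a b, mul_assoc, h1, mul_one]
  have h4 : a * b * b = a := by rw [mul_assoc, h2, mul_one]
  rw [h3, h4]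
  rw [neg_smul, sub_eq_add_neg]

lemma kd_univ_erase {N : ℕ} (z : Finset (Fin N) → MvPolynomial (Fin N) K) (j : Fin N) :
    kd z (Finset.univ.erase j) = ksgn j Finset.univ • (X j * z Finset.univ) := by
  unfold kd
  have : (Finset.univ.erase j : Finset (Fin N))ᶜ = {j} := by ext; simp
  rw [this, Finset.sum_singleton, ksgn_erase_self, Finset.insert_erase (Finset.mem_univ _)]

lemma card_eq_erase {m : ℕ} (S : Finset (Fin (m + 2))) (hS : S.card = m + 1) :
    ∃ j, S = Finset.univ.erase j := by
  have h : Sᶜ.card = 1 := by rw [Finset.card_compl, hS]; simp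
  obtain ⟨j, hj⟩ := Finset.card_eq_one.mp h
  refine ⟨j, ?_⟩
  rw [← compl_compl S, hj]
  ext; simp

lemma card_eq_pair {m : ℕ} (S : Finset (Fin (m + 2))) (hS : S.card = m) :
    ∃ i j, i < j ∧ S = ({i, j} : Finset (Fin (m + 2)))ᶜ := by
  have h : Sᶜ.card = 2 := by rw [Finset.card_compl, hS]; simp
  obtain ⟨i, j, hij, hj⟩ := Finset.card_eq_two.mp h
  rcases lt_or_gt_of_ne hij with h | h
  · exact ⟨i, j, h, by rw [← hj, compl_compl]⟩
  · exact ⟨j, i, h, by rw [Finset.pair_comm, ← hj, compl_compl]⟩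

lemma zsmul_mem_ideal {N : ℕ} (I : Ideal (MvPolynomial (Fin N) K)) {f : MvPolynomial (Fin N) K}
    (c : ℤ) (hf : f ∈ I) : c • f ∈ I := by
  rw [zsmul_eq_mul]; exact I.mul_mem_left _ hf

lemma ksgn_smul_mem_iff {N : ℕ} (I : Ideal (MvPolynomial (Fin N) K)) {f : MvPolynomial (Fin N) K}
    (i j : Fin N) (S : Finset (Fin N)) (hf : (ksgn i S * ksgn j S) • f ∈ I) : f ∈ I := by
  have := zsmul_mem_ideal I (ksgn i S * ksgn j S) hf
  rw [smul_smul] at this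
  have h : ksgn i S * ksgn j S * (ksgn i S * ksgn j S) = 1 := by
    have h1 := ksgn_mul_self i S
    have h2 := ksgn_mul_self j S
    calc _ = (ksgn i S * ksgn i S) * (ksgn j S * ksgn j S) := by ring
      _ = 1 := by rw [h1, h2]; ring
  rwa [h, one_smul] at this

lemma GCx.MM_last_iff [CharZero K] {m : ℕ} (F : GCx (m + 2) K) (hu : Unique (F.ι 0))
    (h0 : ∀ i, F.tw 0 i = 0) (I : Ideal (MvPolynomial (Fin (m + 2)) K))
    (hI : ∀ f, f ∈ I ↔ ∃ y : F.ι 1 → MvPolynomial (Fin (m + 2)) K,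
      f = ∑ i', F.D 0 default i' * y i') (e : ℕ) :
    F.MM e m 0 ↔ ∃ d, d + (m + 1) = e ∧ Soc I d := by
  constructor
  · rintro ⟨z, hz, ⟨x, hx, hzx⟩, hn⟩
    have hed : m + 1 ≤ e := by
      by_contra hlt
      apply hn
      refine ⟨0, 0, fun i S => ⟨fun _ => rfl, GH.zero _ _⟩, fun i S => ⟨fun _ => rfl, GH.zero _ _⟩, ?_⟩
      funext i S
      by_cases hS : S.card = m + 1
      · rcases (hz i S).2 with h | ⟨r, hr, h⟩
        · rw [h]; simp [dD, kD, kd]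
        · rw [hS] at h; omega
      · rw [(hz i S).1 hS]; simp [dD, kD, kd]
    obtain ⟨d, rfl⟩ := Nat.exists_eq_add_of_le' hed
    refine ⟨d, rfl, fun j => ksgn j Finset.univ • z default (Finset.univ.erase j), ?_, ?_, ?_⟩
    · intro j
      beta_reduce
      rcases (hz default (Finset.univ.erase j)).2.zsmul (ksgn j Finset.univ) with h | ⟨r, hr, h⟩
      · rw [h]; exact isHomogeneous_zero _ _ _
      · rw [Finset.card_erase_of_mem (Finset.mem_univ _), h0] at h
        simp at h
        obtain rfl : r = d := by omega
        exact hr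
    · have key : ∀ S, kd (z default) S ∈ I := by
        intro S
        rw [hI]
        refine ⟨fun i => x i S, ?_⟩
        exact (congrFun (congrFun hzx default) S).symm
      have lt_case : ∀ i j, i < j → X i * (ksgn j Finset.univ • z default (Finset.univ.erase j)) -
          X j * (ksgn i Finset.univ • z default (Finset.univ.erase i)) ∈ I := by
        intro i j hij
        have h := key ({i, j} : Finset (Fin (m + 2)))ᶜ
        rw [kd_pair _ _ _ hij] at h
        exact ksgn_smul_mem_iff I i j _ h
      intro i j
      rcases lt_trichotomy i j with h | rfl | h
      · exact lt_case i j h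
      · simp
      · rw [← neg_sub]; exact I.neg_mem (lt_case j i h)
    · rintro ⟨h, hh, hmem⟩
      apply hn
      let w : F.ι 0 → Finset (Fin (m + 2)) → MvPolynomial (Fin (m + 2)) K :=
        fun _ S => if S = Finset.univ then h else 0
      have hw : HH (F.tw 0) (d + (m + 1)) (m + 2) w := by
        intro i S
        constructor
        · intro hS
          have : S ≠ Finset.univ := by rintro rfl; simp at hS
          simp [w, this]
        · dsimp only [w]
          split_ifs with hS
          · rw [hS, h0]
            rcases hh with h | ⟨r, hr, h⟩
            · exact Or.inl h
            · refine Or.inr ⟨r, hr, ?_⟩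
              simp; omega
          · exact GH.zero _ _
      obtain ⟨a, ha, ha'⟩ := F.dD_lift (hz.sub hw.kD) (by
        intro S hS
        obtain ⟨j, rfl⟩ := card_eq_erase S hS
        have h1 := zsmul_mem_ideal I (ksgn j Finset.univ) (hmem j)
        rw [smul_sub, smul_smul, ksgn_mul_self, one_smul, hI] at h1
        obtain ⟨y, hy⟩ := h1
        refine ⟨y, fun i => ?_⟩
        obtain rfl := hu.eq_default i
        rw [← hy]
        change z default _ - kd (w default) _ = _
        rw [kd_univ_erase]
        simp [w])
      exact ⟨a, w, ha, hw, by rw [ha']; abel⟩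
  · rintro ⟨d, rfl, g, hg, hgI, hn⟩
    let z : F.ι 0 → Finset (Fin (m + 2)) → MvPolynomial (Fin (m + 2)) K :=
      fun _ S => ∑ j, if S = Finset.univ.erase j then ksgn j Finset.univ • g j else 0
    have hzj : ∀ i j, z i (Finset.univ.erase j) = ksgn j Finset.univ • g j := by
      intro i j
      simp only [z]
      rw [Finset.sum_eq_single j]
      · simp
      · intro k _ hk
        rw [if_neg]
        intro h
        have : k ∈ Finset.univ.erase j := by simp [hk]
        rw [h] at this
        simp at this
      · simp
    have hz : HH (F.tw 0) (d + (m + 1)) (m + 1) z := by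
      intro i S
      have h1 : S.card ≠ m + 1 → z i S = 0 := by
        intro hS
        refine Finset.sum_eq_zero fun j _ => ?_
        rw [if_neg]
        rintro rfl
        simp [Finset.card_erase_of_mem] at hS
      refine ⟨h1, ?_⟩
      by_cases hS : S.card = m + 1
      · obtain ⟨j, rfl⟩ := card_eq_erase S hS
        rw [hzj i, hS, h0]
        exact GH.zsmul _ (Or.inr ⟨d, hg j, by omega⟩)
      · rw [h1 hS]; exact GH.zero _ _
    refine ⟨z, hz, F.dD_lift hz.kD ?_, ?_⟩
    · intro S hS
      obtain ⟨i, j, hij, rfl⟩ := card_eq_pair S hS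
      have h1 : kd (z default) ({i, j} : Finset (Fin (m + 2)))ᶜ ∈ I := by
        rw [kd_pair _ _ _ hij, hzj default, hzj default, smul_smul, smul_smul, ksgn_mul_self, ksgn_mul_self,
          one_smul, one_smul]
        exact zsmul_mem_ideal I _ (hgI i j)
      obtain ⟨y, hy⟩ := (hI _).mp h1
      refine ⟨y, fun k => ?_⟩
      obtain rfl := hu.eq_default k
      exact hy
    · rintro ⟨a, b, ha, hb, hab⟩
      apply hn
      refine ⟨b default Finset.univ, ?_, fun j => ?_⟩
      · rcases (hb default Finset.univ).2 with h | ⟨r, hr, h⟩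
        · exact Or.inl h
        · refine Or.inr ⟨r, hr, ?_⟩
          rw [h0] at h
          simp at h; omega
      · have h1 := congrFun (congrFun hab default) (Finset.univ.erase j)
        rw [hzj default] at h1
        have h2 : F.dD a default (Finset.univ.erase j) ∈ I := by
          rw [hI]; exact ⟨fun i => a i _, rfl⟩
        have h3 : F.dD a default (Finset.univ.erase j) = ksgn j Finset.univ •
            (g j - X j * b default Finset.univ) := by
          rw [smul_sub, h1]
          change _ = F.dD a default _ + kd (b default) _ - _
          rw [kd_univ_erase]; abel
        rw [h3] at h2
        have h4 := zsmul_mem_ideal I (ksgn j Finset.univ) h2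
        rwa [smul_smul, ksgn_mul_self, one_smul] at h4

end Socle

section FromRes

/-- index types of the resolution, including `F_0 = R`. -/
def resIx {N : ℕ} {I : Ideal (MvPolynomial (Fin N) K)} (res : MinFreeRes N K I) : ℕ → Type
  | 0 => Unit
  | q + 1 => Fin (res.rk (q + 1))

/-- The complex of a resolution. -/
def resCx {N : ℕ} {I : Ideal (MvPolynomial (Fin N) K)} (res : MinFreeRes N K I) : GCx N K where
  ι := resIx res
  ft q := match q with
    | 0 => inferInstanceAs (Fintype Unit)
    | q + 1 => inferInstanceAs (Fintype (Fin (res.rk (q + 1))))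
  tw q := match q with
    | 0 => fun _ => 0
    | q + 1 => res.twist (q + 1)
  D q := match q with
    | 0 => fun _ i => res.gen i
    | q + 1 => res.mat q
  hom q := match q with
    | 0 => fun _ i => Or.inr ⟨res.twist 1 i, res.gen_hom i, by simp⟩
    | q + 1 => res.mat_hom q
  mini q := match q with
    | 0 => fun _ i => res.gen_min i
    | q + 1 => res.mat_min q
  exact q := match q with
    | 0 => fun y => by
      have h := res.exact_one y
      constructor
      · intro h1
        obtain ⟨z, hz⟩ := h.mp (by
          rw [← h1 ()]
          exact Finset.sum_congr rfl fun i _ => mul_comm _ _)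
        exact ⟨z, fun i => (congrFun hz i).symm⟩
      · rintro ⟨z, hz⟩ _
        have h2 := h.mpr ⟨z, funext fun i => (hz i).symm⟩
        rw [← h2]
        exact Finset.sum_congr rfl fun i _ => mul_comm _ _
    | q + 1 => fun y => by
      have h := SetLike.ext_iff.mp (res.exact_rest q) y
      have h : (res.mat q).mulVecLin y = 0 ↔ ∃ z, (res.mat (q + 1)).mulVecLin z = y := h
      constructor
      · intro h1
        obtain ⟨z, hz⟩ := h.mp (funext h1)
        exact ⟨z, fun i => (congrFun hz i).symm⟩
      · rintro ⟨z, hz⟩ i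
        exact congrFun (h.mpr ⟨z, funext fun i => (hz i).symm⟩) i

theorem twist_iff_soc [CharZero K] {m : ℕ} {I : Ideal (MvPolynomial (Fin (m + 2)) K)}
    (res : MinFreeRes (m + 2) K I) (hlen : res.len = m + 1) (e : ℕ) :
    (∃ i, res.twist (m + 1) i = e) ↔ ∃ d, d + (m + 1) = e ∧ Soc I d := by
  have h1 : IsEmpty ((resCx res).ι (m + 2)) := by
    change IsEmpty (Fin (res.rk (m + 2)))
    rw [res.rk_eq_zero (m + 2) (by omega)]
    infer_instance
  have hu : Unique ((resCx res).ι 0) := inferInstanceAs (Unique Unit)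
  have h2 := (resCx res).NN_zero_iff e m h1
  have h3 := (resCx res).NN_iff_MM_zero e m 0
  rw [zero_add] at h3
  rw [← (resCx res).MM_last_iff hu (fun _ => rfl) I ?_ e, ← h3, h2]
  · rfl
  · intro f
    have hs : f ∈ I ↔ f ∈ Ideal.span (Set.range res.gen) := by rw [res.gen_span]
    rw [hs, Ideal.mem_span_range_iff_exists_fun]
    constructor
    · rintro ⟨c, hc⟩
      refine ⟨c, ?_⟩
      rw [← hc]
      exact Finset.sum_congr rfl fun i _ => mul_comm _ _
    · rintro ⟨c, hc⟩
      refine ⟨c, ?_⟩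
      rw [hc]
      exact Finset.sum_congr rfl fun i _ => mul_comm _ _

end FromRes

section Geometry

lemma eval_smul_hom {N : ℕ} {f : MvPolynomial (Fin N) K} {d : ℕ} (hf : f.IsHomogeneous d)
    (a : K) (w : Fin N → K) : eval (a • w) f = a ^ d * eval w f := by
  rw [eval_eq, eval_eq, Finset.mul_sum]
  refine Finset.sum_congr rfl fun m hm => ?_
  have h : ∑ i ∈ m.support, m i = d := hf.degree_eq_sum_deg_support hm ▸ rfl
  simp only [Pi.smul_apply, smul_eq_mul, mul_pow]
  rw [Finset.prod_mul_distrib, Finset.prod_pow_eq_pow_sum, h]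
  ring

lemma vanish_mk_iff {N : ℕ} {f : MvPolynomial (Fin N) K} {d : ℕ} (hf : f.IsHomogeneous d)
    (w : Fin N → K) (hw : w ≠ 0) :
    (∀ (v : Fin N → K) (hv : v ≠ 0), Projectivization.mk K v hv = Projectivization.mk K w hw →
      eval v f = 0) ↔ eval w f = 0 := by
  constructor
  · intro h; exact h w hw rfl
  · intro h v hv hvw
    obtain ⟨a, rfl⟩ := (Projectivization.mk_eq_mk_iff' K v w hv hw).mp hvw
    rw [eval_smul_hom hf, h, mul_zero]

lemma mem_vanish_iff {N : ℕ} {f : MvPolynomial (Fin N) K} {d : ℕ} (hf : f.IsHomogeneous d)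
    (Γ : Set (Projectivization K (Fin N → K))) :
    f ∈ vanishingIdeal Γ ↔ ∀ P ∈ Γ, eval P.rep f = 0 := by
  change (∀ P ∈ Γ, ∀ (v : Fin N → K) (hv : v ≠ 0), Projectivization.mk K v hv = P →
    eval v f = 0) ↔ _
  refine forall_congr' fun P => imp_congr_right fun _ => ?_
  have h := vanish_mk_iff hf P.rep P.rep_nonzero
  rwa [Projectivization.mk_rep] at h

/-- Points of the plane spanned by the line. -/
def lv (n : ℕ) (a b : K) : Fin (n + 1) → K := fun j => if (j : ℕ) = 1 then b else a

lemma mem_Mig_iff {n β : ℕ} {f : MvPolynomial (Fin (n + 1)) K} {d : ℕ} (hf : f.IsHomogeneous d)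
    (Γ₀ : Finset (Projectivization K (Fin n → K))) (u : Fin β → K) :
    f ∈ vanishingIdeal ((MigGamma Γ₀ u) : Set (Projectivization K (Fin (n + 1) → K))) ↔
      (∀ P ∈ Γ₀, eval (Fin.cons 0 P.rep) f = 0) ∧ ∀ i, eval (lv n 1 (u i)) f = 0 := by
  change (∀ P ∈ ((MigGamma Γ₀ u) : Set (Projectivization K (Fin (n + 1) → K))),
    ∀ (v : Fin (n + 1) → K) (hv : v ≠ 0), Projectivization.mk K v hv = P → eval v f = 0) ↔ _
  constructor
  · intro h
    constructor
    · intro P hP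
      have hmem : embedPt P ∈ ((MigGamma Γ₀ u) : Set (Projectivization K (Fin (n + 1) → K))) := by
        simp only [MigGamma, Finset.coe_union, Finset.coe_image]
        exact Or.inl ⟨P, hP, rfl⟩
      exact (vanish_mk_iff hf _ _).mp (h (embedPt P) hmem)
    · intro i
      have hmem : linePt n (u i) ∈
          ((MigGamma Γ₀ u) : Set (Projectivization K (Fin (n + 1) → K))) := by
        simp only [MigGamma, Finset.coe_union, Finset.coe_image]
        exact Or.inr ⟨i, by simp, rfl⟩
      exact (vanish_mk_iff hf _ _).mp (h (linePt n (u i)) hmem)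
  · rintro ⟨h1, h2⟩ P hP
    simp only [MigGamma, Finset.coe_union, Finset.coe_image] at hP
    rcases hP with ⟨Q, hQ, rfl⟩ | ⟨i, -, rfl⟩
    · exact (vanish_mk_iff hf _ _).mpr (h1 Q hQ)
    · exact (vanish_mk_iff hf _ _).mpr (h2 i)

lemma comp_eval [CharZero K] {N : ℕ} (f : MvPolynomial (Fin N) K) (w : Fin N → K) (c : K) (v : ℕ)
    (h : ∀ t : K, t ≠ 0 → eval (t • w) f = c * t ^ v) (i : ℕ) :
    eval w (homogeneousComponent i f) = if i = v then c else 0 := by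
  let p : Polynomial K := ∑ i ∈ Finset.range (f.totalDegree + 1),
    Polynomial.C (eval w (homogeneousComponent i f)) * Polynomial.X ^ i
  have hp : p = Polynomial.C c * Polynomial.X ^ v := by
    refine Polynomial.eq_of_infinite_eval_eq _ _ (Set.Infinite.mono (s := {t | t ≠ 0}) ?_ ?_)
    · intro t ht
      have h1 := h t ht
      rw [← sum_homogeneousComponent f, map_sum] at h1
      simp only [Set.mem_setOf_eq, p, Polynomial.eval_finset_sum, Polynomial.eval_mul,
        Polynomial.eval_C, Polynomial.eval_pow, Polynomial.eval_X]
      rw [← h1]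
      refine Finset.sum_congr rfl fun i _ => ?_
      rw [eval_smul_hom (homogeneousComponent_isHomogeneous i f), mul_comm]
    · exact (Set.finite_singleton (0 : K)).infinite_compl
  have h2 := congrArg (fun q => Polynomial.coeff q i) hp
  simp only [p, Polynomial.finset_sum_coeff, Polynomial.coeff_C_mul, Polynomial.coeff_X_pow] at h2
  simp only [mul_ite, mul_one, mul_zero] at h2
  rw [← h2, Finset.sum_ite_eq]
  split_ifs with hi
  · rfl
  · rw [homogeneousComponent_eq_zero _ _ (by simpa using hi), map_zero]

lemma comp_mem_vanish [CharZero K] {N : ℕ} {f : MvPolynomial (Fin N) K}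
    {Γ : Set (Projectivization K (Fin N → K))} (hf : f ∈ vanishingIdeal Γ) (i : ℕ) :
    homogeneousComponent i f ∈ vanishingIdeal Γ := by
  rw [mem_vanish_iff (homogeneousComponent_isHomogeneous i f)]
  intro P hP
  rw [comp_eval f P.rep 0 0]
  · simp
  · intro t ht
    rw [zero_mul]
    refine hf P hP _ (smul_ne_zero ht P.rep_nonzero) ?_
    conv_rhs => rw [← P.mk_rep]
    rw [Projectivization.mk_eq_mk_iff']
    exact ⟨t, rfl⟩

lemma exists_q [CharZero K] {k v : ℕ} (Γ₀ : Set (Projectivization K (Fin (k + 2) → K)))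
    (hv : vanishingIdeal Γ₀ ⊔ Ideal.span {f | ∃ i : Fin (k + 2), 1 ≤ (i : ℕ) ∧ f = X i} =
      Ideal.span ({X (0 : Fin (k + 2)) ^ v} ∪ {f | ∃ i : Fin (k + 2), 1 ≤ (i : ℕ) ∧ f = X i})) :
    ∃ q ∈ vanishingIdeal Γ₀, q.IsHomogeneous v ∧ eval (Pi.single 0 1) q = 1 := by
  have h1 : (X 0 ^ v : MvPolynomial (Fin (k + 2)) K) ∈ vanishingIdeal Γ₀ ⊔
      Ideal.span {f | ∃ i : Fin (k + 2), 1 ≤ (i : ℕ) ∧ f = X i} := by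
    rw [hv]; exact Ideal.subset_span (Or.inl rfl)
  obtain ⟨q, hq, r, hr, hqr⟩ := Submodule.mem_sup.mp h1
  refine ⟨homogeneousComponent v q, comp_mem_vanish hq v, homogeneousComponent_isHomogeneous v q, ?_⟩
  rw [comp_eval q _ 1 v, if_pos rfl]
  intro t _
  have h2 : eval (t • (Pi.single 0 1 : Fin (k + 2) → K)) r = 0 := by
    have : Ideal.span {f | ∃ i : Fin (k + 2), 1 ≤ (i : ℕ) ∧ f = X i} ≤
        RingHom.ker (eval (t • (Pi.single 0 1 : Fin (k + 2) → K))) := by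
      rw [Ideal.span_le]
      rintro _ ⟨i, hi, rfl⟩
      have : i ≠ 0 := by rintro rfl; simp at hi
      simp [RingHom.mem_ker, this]
    exact this hr
  have h3 := congrArg (eval (t • (Pi.single 0 1 : Fin (k + 2) → K))) hqr
  rw [map_add, h2, add_zero] at h3
  rw [h3]; simp

lemma le_of_eval_ne {k v d : ℕ} (Γ₀ : Set (Projectivization K (Fin (k + 2) → K)))
    (hv : vanishingIdeal Γ₀ ⊔ Ideal.span {f | ∃ i : Fin (k + 2), 1 ≤ (i : ℕ) ∧ f = X i} =
      Ideal.span ({X (0 : Fin (k + 2)) ^ v} ∪ {f | ∃ i : Fin (k + 2), 1 ≤ (i : ℕ) ∧ f = X i}))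
    {q : MvPolynomial (Fin (k + 2)) K} (hq : q ∈ vanishingIdeal Γ₀) (hd : q.IsHomogeneous d)
    (h1 : eval (Pi.single 0 1) q ≠ 0) : v ≤ d := by
  let φ : MvPolynomial (Fin (k + 2)) K →ₐ[K] Polynomial K :=
    aeval (fun i => if i = 0 then Polynomial.X else 0)
  have h2 : q ∈ Ideal.span ({X (0 : Fin (k + 2)) ^ v} ∪
      {f | ∃ i : Fin (k + 2), 1 ≤ (i : ℕ) ∧ f = X i}) := by
    rw [← hv]; exact Submodule.mem_sup_left hq
  have h3 : Ideal.span ({X (0 : Fin (k + 2)) ^ v} ∪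
      {f | ∃ i : Fin (k + 2), 1 ≤ (i : ℕ) ∧ f = X i}) ≤
      Ideal.comap φ (Ideal.span {Polynomial.X ^ v}) := by
    rw [Ideal.span_le]
    rintro _ (rfl | ⟨i, hi, rfl⟩)
    · simp [φ, Ideal.mem_span_singleton]
    · have : i ≠ 0 := by rintro rfl; simp at hi
      simp [φ, this]
  have h4 : Polynomial.X ^ v ∣ φ q := Ideal.mem_span_singleton.mp (h3 h2)
  have h5 : Polynomial.eval 1 (φ q) = eval (Pi.single 0 1) q := by
    have : (Polynomial.evalRingHom (1 : K)).comp (φ : MvPolynomial (Fin (k + 2)) K →+* Polynomial K) =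
        eval (Pi.single 0 1) := by
      refine MvPolynomial.ringHom_ext (by intro r; simp) fun i => ?_
      by_cases hi : i = 0
      · subst hi; simp [φ]
      · simp [φ, hi]
    exact DFunLike.congr_fun this q
  have h6 : φ q ≠ 0 := by
    intro h; rw [h, Polynomial.eval_zero] at h5; exact h1 h5.symm
  have h7 := Polynomial.natDegree_le_of_dvd h4 h6
  rw [Polynomial.natDegree_X_pow] at h7
  have h8 := aeval_natDegree_le (n := 1) q hd.totalDegree_le
    (fun i => if i = 0 then Polynomial.X else 0) (by intro i; split_ifs <;> simp)
  have h9 : (φ q).natDegree ≤ d * 1 := h8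
  omega

lemma line_lemma [CharZero K] {n β d : ℕ} {f : MvPolynomial (Fin (n + 1)) K}
    (hf : f.IsHomogeneous d) (hd : d < β) (u : Fin β → K) (hu : Function.Injective u)
    (h : ∀ i, eval (lv n 1 (u i)) f = 0) (a b : K) : eval (lv n a b) f = 0 := by
  have ev : ∀ (A B : Polynomial K) (t : K),
      Polynomial.eval t (aeval (fun j : Fin (n + 1) => if (j : ℕ) = 1 then B else A) f) =
      eval (lv n (A.eval t) (B.eval t)) f := by
    intro A B t
    have : (Polynomial.evalRingHom t).comp
        ((aeval (fun j : Fin (n + 1) => if (j : ℕ) = 1 then B else A) :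
          MvPolynomial (Fin (n + 1)) K →ₐ[K] Polynomial K) :
          MvPolynomial (Fin (n + 1)) K →+* Polynomial K) =
        eval (lv n (A.eval t) (B.eval t)) := by
      refine MvPolynomial.ringHom_ext (by intro r; simp) fun i => ?_
      by_cases hi : (i : ℕ) = 1
      · simp [lv, hi]
      · simp [lv, hi]
    exact DFunLike.congr_fun this f
  have h1 : ∀ b, eval (lv n 1 b) f = 0 := by
    have hz : aeval (fun j : Fin (n + 1) => if (j : ℕ) = 1 then Polynomial.X else
        (1 : Polynomial K)) f = 0 := by
      by_contra hne
      have hdeg := aeval_natDegree_le (n := 1) f hf.totalDegree_le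
        (fun j : Fin (n + 1) => if (j : ℕ) = 1 then Polynomial.X else (1 : Polynomial K))
        (by intro i; split_ifs <;> simp)
      have hc := Polynomial.card_le_degree_of_subset_roots (p := aeval (fun j : Fin (n + 1) =>
        if (j : ℕ) = 1 then Polynomial.X else (1 : Polynomial K)) f)
        (Z := Finset.univ.map ⟨u, hu⟩) (by
          intro x hx
          simp only [Finset.mem_val, Finset.mem_map, Finset.mem_univ, true_and,
            Function.Embedding.coeFn_mk] at hx
          obtain ⟨i, rfl⟩ := hx
          rw [Polynomial.mem_roots hne, Polynomial.IsRoot.def, ev]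
          simpa using h i)
      simp at hc
      omega
    intro b
    have := ev 1 Polynomial.X b
    rw [hz] at this
    simpa using this.symm
  have h2 : ∀ a, a ≠ 0 → ∀ b, eval (lv n a b) f = 0 := by
    intro a ha b
    have : lv n a b = a • lv n 1 (a⁻¹ * b) := by
      funext j
      by_cases hj : (j : ℕ) = 1
      · simp [lv, hj, ha]
      · simp [lv, hj]
    rw [this, eval_smul_hom hf, h1, mul_zero]
  have h3 : aeval (fun j : Fin (n + 1) => if (j : ℕ) = 1 then Polynomial.C b else
      (Polynomial.X : Polynomial K)) f = 0 := by
    refine Polynomial.eq_zero_of_infinite_isRoot _ (Set.Infinite.mono (s := {t | t ≠ 0}) ?_ ?_)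
    · intro t ht
      simp only [Set.mem_setOf_eq, Polynomial.IsRoot.def]
      rw [ev]
      simpa using h2 t ht b
    · exact (Set.finite_singleton (0 : K)).infinite_compl
  have := ev Polynomial.X (Polynomial.C b) a
  rw [h3] at this
  simpa using this.symm

lemma finrank_hom_le (n d : ℕ) (hn : 1 ≤ n) :
    Module.finrank K (homogeneousSubmodule (Fin n) K d) ≤ (d + n - 1).choose (n - 1) := by
  classical
  have h1 : homogeneousSubmodule (Fin n) K d ≤ Submodule.span K
      (((Finset.univ.finsuppAntidiag d : Finset (Fin n →₀ ℕ)).image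
        (fun m => (monomial m (1 : K)))) : Set (MvPolynomial (Fin n) K)) := by
    intro f hf
    rw [f.as_sum]
    refine Submodule.sum_mem _ fun m hm => ?_
    have : monomial m (coeff m f) = coeff m f • monomial m (1 : K) := by
      rw [smul_monomial, smul_eq_mul, mul_one]
    rw [this]
    refine Submodule.smul_mem _ _ (Submodule.subset_span ?_)
    simp only [Finset.coe_image]
    refine ⟨m, ?_, rfl⟩
    have hdeg : m.degree = d := by
      by_contra hne
      exact (mem_support_iff.mp hm) (IsHomogeneous.coeff_eq_zero hf hne)
    simp only [Finset.mem_coe, Finset.mem_finsuppAntidiag, Finset.subset_univ, and_true]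
    rw [← hdeg, Finsupp.degree_eq_sum]
  have h2 := Submodule.finrank_mono h1
  refine h2.trans ((finrank_span_finset_le_card _).trans (Finset.card_image_le.trans ?_))
  rw [Finset.card_finsuppAntidiag_nat_eq_choose, Finset.card_univ, Fintype.card_fin]
  have : n + d - 1 = d + n - 1 := by omega
  rw [this]
  rw [← Nat.choose_symm (by omega : d ≤ d + n - 1)]
  have : d + n - 1 - d = n - 1 := by omega
  rw [this]

lemma J_zero {n α s : ℕ} (hn : 1 ≤ n) (J : Ideal (MvPolynomial (Fin n) K))
    (hgen : ∀ i, HF J i = min ((i + n - 1).choose (n - 1)) α)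
    (hsmin : ∀ j, α < (j + n - 1).choose (n - 1) → s ≤ j) {d : ℕ} (hd : d < s)
    {f : MvPolynomial (Fin n) K} (hf : f.IsHomogeneous d) (hJ : f ∈ J) : f = 0 := by
  have h1 : (d + n - 1).choose (n - 1) ≤ α := by
    by_contra h
    have := hsmin d (by omega)
    omega
  have h2 := hgen d
  rw [min_eq_left h1] at h2
  have h3 := finrank_hom_le (K := K) n d hn
  have h4 : 0 < (d + n - 1).choose (n - 1) := Nat.choose_pos (by omega)
  have h5 : hdim J d = 0 := by
    unfold HF at h2; omega
  haveI : Module.Finite K (homogeneousSubmodule (Fin n) K d) :=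
    Module.Finite.iff_fg.mpr (homogeneousSubmodule_fg (Fin n) K d)
  haveI : Module.Finite K (degPart J d) :=
    Submodule.finiteDimensional_of_le (inf_le_right : degPart J d ≤ homogeneousSubmodule (Fin n) K d)
  have h6 : degPart J d = ⊥ := Submodule.finrank_eq_zero.mp h5
  have h7 : f ∈ degPart J d := ⟨hJ, hf⟩
  rw [h6] at h7
  simpa using h7

lemma hom_of_X_mul {N d : ℕ} {i : Fin N} {h : MvPolynomial (Fin N) K}
    (hd : (X i * h).IsHomogeneous d) : GH h 1 d := by
  by_cases h0 : h = 0
  · exact Or.inl h0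
  · right
    have key : ∀ m, coeff m h ≠ 0 → m.degree + 1 = d := by
      intro m hm
      have h1 : coeff (Finsupp.single i 1 + m) (X i * h) ≠ 0 := by rwa [coeff_X_mul]
      by_contra hne
      apply h1
      apply hd.coeff_eq_zero
      rw [map_add, Finsupp.degree_single]
      omega
    obtain ⟨m, hm⟩ := ne_zero_iff.mp h0
    have hk := key m hm
    refine ⟨m.degree, ?_, hk⟩
    intro m' hm'
    have h2 := key m' hm'
    have h3 : Finsupp.weight 1 m' = Finsupp.degree m' :=
      (DFunLike.congr_fun (Finsupp.degree_eq_weight_one (R := ℕ) (σ := Fin N)) m').symm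
    rw [h3]
    omega

end Geometry
section Final

/-- Restriction to the hyperplane `x_0 = 0`. -/
def rho (K : Type) [Field K] (n : ℕ) :
    MvPolynomial (Fin (n + 1)) K →ₐ[K] MvPolynomial (Fin n) K :=
  aeval (Fin.cons 0 X : Fin (n + 1) → MvPolynomial (Fin n) K)

/-- Restriction to the line, as a form in `x_0, x_1`. -/
def tau (K : Type) [Field K] (k : ℕ) :
    MvPolynomial (Fin (k + 2)) K →ₐ[K] MvPolynomial (Fin (k + 3)) K :=
  aeval (fun i : Fin (k + 2) => if i = 0 then X 1 else X 0)

lemma eval_rho {n : ℕ} (w : Fin n → K) (f : MvPolynomial (Fin (n + 1)) K) :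
    eval w (rho K n f) = eval (Fin.cons 0 w) f := by
  have : (eval w).comp (rho K n : MvPolynomial (Fin (n + 1)) K →+* MvPolynomial (Fin n) K) =
      eval (Fin.cons 0 w) := by
    refine MvPolynomial.ringHom_ext (by intro r; simp [rho]) fun i => ?_
    refine Fin.cases ?_ (fun j => ?_) i <;> simp [rho]
  exact DFunLike.congr_fun this f

lemma eval_tau {k : ℕ} (w : Fin (k + 3) → K) (f : MvPolynomial (Fin (k + 2)) K) :
    eval w (tau K k f) = eval (fun i => if i = 0 then w 1 else w 0) f := by
  have : (eval w).comp (tau K k : MvPolynomial (Fin (k + 2)) K →+* MvPolynomial (Fin (k + 3)) K) =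
      eval (fun i => if i = 0 then w 1 else w 0) := by
    refine MvPolynomial.ringHom_ext (by intro r; simp [tau]) fun i => ?_
    by_cases hi : i = 0 <;> simp [tau, hi]
  exact DFunLike.congr_fun this f

lemma rho_hom {n d : ℕ} {f : MvPolynomial (Fin (n + 1)) K} (hf : f.IsHomogeneous d) :
    (rho K n f).IsHomogeneous d := by
  have := hf.aeval (Fin.cons 0 X : Fin (n + 1) → MvPolynomial (Fin n) K) (n := 1) (by
    intro i
    refine Fin.cases ?_ (fun j => ?_) i
    · simpa using isHomogeneous_zero _ _ _
    · simpa using isHomogeneous_X _ _)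
  simpa [rho] using this

lemma tau_hom {k d : ℕ} {f : MvPolynomial (Fin (k + 2)) K} (hf : f.IsHomogeneous d) :
    (tau K k f).IsHomogeneous d := by
  have := hf.aeval (fun i : Fin (k + 2) => if i = 0 then
      (X 1 : MvPolynomial (Fin (k + 3)) K) else X 0) (n := 1) (by
    intro i
    split_ifs <;> exact isHomogeneous_X _ _)
  simpa [tau] using this

lemma rho_X_zero (n : ℕ) : rho K n (X 0) = 0 := by simp [rho]

lemma rho_X_succ {n : ℕ} (j : Fin n) : rho K n (X j.succ) = X j := by simp [rho]

lemma X_zero_dvd {n : ℕ} {f : MvPolynomial (Fin (n + 1)) K} (h : rho K n f = 0) : X 0 ∣ f := by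
  have key : ((Ideal.Quotient.mkₐ K (Ideal.span {(X 0 : MvPolynomial (Fin (n + 1)) K)})).comp
      (rename Fin.succ)).comp (rho K n) =
      Ideal.Quotient.mkₐ K (Ideal.span {(X 0 : MvPolynomial (Fin (n + 1)) K)}) := by
    refine MvPolynomial.algHom_ext fun i => ?_
    refine Fin.cases ?_ (fun j => ?_) i
    · simp only [AlgHom.comp_apply, rho_X_zero, map_zero]
      symm
      exact Ideal.Quotient.eq_zero_iff_mem.mpr (Ideal.mem_span_singleton_self _)
    · simp only [AlgHom.comp_apply, rho_X_succ, rename_X]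
  have h1 := DFunLike.congr_fun key f
  simp only [AlgHom.comp_apply, h, map_zero] at h1
  exact Ideal.mem_span_singleton.mp (Ideal.Quotient.eq_zero_iff_mem.mp h1.symm)

lemma GH_pred {N d : ℕ} {h : MvPolynomial (Fin N) K} (hh : GH h 1 d) : h.IsHomogeneous (d - 1) := by
  rcases hh with rfl | ⟨r, hr, rfl⟩
  · exact isHomogeneous_zero _ _ _
  · exact hr

lemma GH_zero {N : ℕ} {h : MvPolynomial (Fin N) K} (hh : GH h 1 0) : h = 0 := by
  rcases hh with rfl | ⟨r, hr, h0⟩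
  · rfl
  · omega

lemma GH_mul {N d : ℕ} {h : MvPolynomial (Fin N) K} (hh : GH h 1 d) (j : Fin N) :
    (X j * h).IsHomogeneous d := by
  rcases hh with rfl | ⟨r, hr, rfl⟩
  · rw [mul_zero]; exact isHomogeneous_zero _ _ _
  · rw [add_comm]; exact (isHomogeneous_X _ _).mul hr

lemma lv_zero_one (k : ℕ) : (lv (k + 2) 0 1 : Fin (k + 3) → K) =
    Fin.cons 0 (Pi.single 0 1 : Fin (k + 2) → K) := by
  funext j
  refine Fin.cases ?_ (fun i => ?_) j
  · simp [lv]
  · by_cases hi : i = 0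
    · subst hi; simp [lv]
    · have : (i : ℕ) ≠ 0 := fun h => hi (Fin.ext h)
      simp [lv, hi]

lemma lv_apply_zero (k : ℕ) (a b : K) : lv (k + 2) a b 0 = a := by simp [lv]

lemma lv_apply_one (k : ℕ) (a b : K) : lv (k + 2) a b 1 = b := by simp [lv]

/-- The correction term has the right values on the hyperplane. -/
lemma corr_hyp {k d : ℕ} {e : MvPolynomial (Fin (k + 2)) K} (he : e.IsHomogeneous d)
    (w : Fin (k + 2) → K) :
    eval (Fin.cons 0 w) (rename Fin.succ e - tau K k e) =
      eval w e - w 0 ^ d * eval (Pi.single 0 1) e := by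
  rw [map_sub, eval_tau, eval_rename, ← eval_smul_hom he]
  have h1 : (Fin.cons 0 w : Fin (k + 3) → K) ∘ Fin.succ = w := by
    funext i; simp
  have h2 : (fun i : Fin (k + 2) => if i = 0 then (Fin.cons 0 w : Fin (k + 3) → K) 1 else
      (Fin.cons 0 w : Fin (k + 3) → K) 0) = w 0 • Pi.single 0 1 := by
    funext i
    by_cases hi : i = 0
    · subst hi
      have h3 : (Fin.cons 0 w : Fin (k + 3) → K) 1 = w 0 := rfl
      rw [if_pos rfl, h3]
      simp
    · simp [hi]
  rw [h1, h2]

/-- The correction term vanishes on the line. -/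
lemma corr_line {k : ℕ} (e : MvPolynomial (Fin (k + 2)) K) (a b : K) :
    eval (lv (k + 2) a b) (rename Fin.succ e - tau K k e) = 0 := by
  rw [map_sub, eval_tau, eval_rename, lv_apply_zero, lv_apply_one, sub_eq_zero]
  congr 1
  congr 1
  funext i
  by_cases hi : i = 0
  · subst hi; simp [lv]
  · have : (i : ℕ) ≠ 0 := fun h => hi (Fin.ext h)
    simp [lv, hi]

lemma soc_upper [CharZero K] {k β v t : ℕ} (Γ₀ : Finset (Projectivization K (Fin (k + 2) → K)))
    (hv : vanishingIdeal (Γ₀ : Set (Projectivization K (Fin (k + 2) → K))) ⊔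
      Ideal.span {f | ∃ i : Fin (k + 2), 1 ≤ (i : ℕ) ∧ f = X i} =
      Ideal.span ({X (0 : Fin (k + 2)) ^ v} ∪ {f | ∃ i : Fin (k + 2), 1 ≤ (i : ℕ) ∧ f = X i}))
    (u : Fin β → K) (hu : Function.Injective u) (h1t : 1 ≤ t) (htv : t ≤ v) (htβ : t ≤ β)
    (Q : MvPolynomial (Fin (k + 3)) K) (hQ : Q.IsHomogeneous t)
    (hQ1 : ∀ P ∈ Γ₀, eval (Fin.cons 0 P.rep) Q = 0)
    (hQ2 : ∀ i, eval (lv (k + 2) 1 (u i)) Q = u i ^ t) :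
    Soc (vanishingIdeal ((MigGamma Γ₀ u) : Set (Projectivization K (Fin (k + 3) → K)))) t := by
  obtain ⟨r, rfl⟩ : ∃ r, t = r + 1 := ⟨t - 1, by omega⟩
  let M : MvPolynomial (Fin (k + 3)) K := X 0 * X 1 ^ r
  have hM : M.IsHomogeneous (r + 1) := by
    rw [add_comm r 1]
    exact (isHomogeneous_X _ _).mul (by simpa using (isHomogeneous_X K (1 : Fin (k + 3))).pow r)
  let g : Fin (k + 3) → MvPolynomial (Fin (k + 3)) K := fun j => if (j : ℕ) = 1 then Q else M
  have hg : ∀ j, (g j).IsHomogeneous (r + 1) := by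
    intro j; dsimp only [g]; split_ifs
    · exact hQ
    · exact hM
  have hg1 : ∀ j, ∀ P ∈ Γ₀, eval (Fin.cons 0 P.rep) (g j) = 0 := by
    intro j P hP; dsimp only [g]; split_ifs
    · exact hQ1 P hP
    · simp [M]
  have hg2 : ∀ j i, eval (lv (k + 2) 1 (u i)) (g j) = lv (k + 2) 1 (u i) j * u i ^ r := by
    intro j i; dsimp only [g]; split_ifs with hj
    · rw [hQ2]; simp only [lv, hj, if_true]; ring
    · simp [M, lv, hj]
  refine ⟨g, hg, ?_, ?_⟩
  · intro i j
    have hh : (X i * g j - X j * g i).IsHomogeneous (1 + (r + 1)) :=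
      ((isHomogeneous_X _ _).mul (hg j)).sub ((isHomogeneous_X _ _).mul (hg i))
    rw [mem_Mig_iff hh]
    constructor
    · intro P hP
      rw [map_sub, map_mul, map_mul, hg1 _ P hP, hg1 _ P hP]; ring
    · intro l
      rw [map_sub, map_mul, map_mul, hg2, hg2, eval_X, eval_X]; ring
  · rintro ⟨h, hGH, hI⟩
    have hhom : h.IsHomogeneous r := GH_pred hGH
    have hI' := fun j => (mem_Mig_iff ((hg j).sub (GH_mul hGH j)) Γ₀ u).mp (hI j)
    have hJ : rho K (k + 2) h ∈
        vanishingIdeal (Γ₀ : Set (Projectivization K (Fin (k + 2) → K))) := by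
      rw [mem_vanish_iff (rho_hom hhom)]
      intro P hP
      rw [eval_rho]
      obtain ⟨i, hi⟩ := Function.ne_iff.mp P.rep_nonzero
      have h1 := (hI' i.succ).1 P hP
      rw [map_sub, hg1 _ P hP, map_mul, eval_X, Fin.cons_succ, zero_sub, neg_eq_zero] at h1
      exact (mul_eq_zero.mp h1).resolve_left hi
    have hX : (X 1 ^ r : MvPolynomial (Fin (k + 3)) K).IsHomogeneous r := by
      simpa using (isHomogeneous_X K (1 : Fin (k + 3))).pow r
    have hl := line_lemma (hhom.sub hX) (by omega : r < β) u hu (by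
      intro i
      have h1 := (hI' 0).2 i
      rw [map_sub, hg2, map_mul, eval_X, lv_apply_zero] at h1
      rw [map_sub, map_pow, eval_X, lv_apply_one]
      linear_combination -h1) 0 1
    rw [map_sub, map_pow, eval_X, lv_apply_one, lv_zero_one, ← eval_rho, one_pow] at hl
    have := le_of_eval_ne _ hv hJ (rho_hom hhom) (by
      rw [sub_eq_zero.mp hl]; exact one_ne_zero)
    omega

lemma soc_v [CharZero K] {k β v : ℕ} (Γ₀ : Finset (Projectivization K (Fin (k + 2) → K)))
    (hv : vanishingIdeal (Γ₀ : Set (Projectivization K (Fin (k + 2) → K))) ⊔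
      Ideal.span {f | ∃ i : Fin (k + 2), 1 ≤ (i : ℕ) ∧ f = X i} =
      Ideal.span ({X (0 : Fin (k + 2)) ^ v} ∪ {f | ∃ i : Fin (k + 2), 1 ≤ (i : ℕ) ∧ f = X i}))
    (u : Fin β → K) (hu : Function.Injective u) (h1 : 1 ≤ v) (h2 : v ≤ β) :
    Soc (vanishingIdeal ((MigGamma Γ₀ u) : Set (Projectivization K (Fin (k + 3) → K)))) v := by
  obtain ⟨q, hq, hqh, hq1⟩ := exists_q _ hv
  have hX : (X 1 ^ v : MvPolynomial (Fin (k + 3)) K).IsHomogeneous v := by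
    simpa using (isHomogeneous_X K (1 : Fin (k + 3))).pow v
  refine soc_upper Γ₀ hv u hu h1 le_rfl h2 (X 1 ^ v + (rename Fin.succ q - tau K k q))
    (hX.add ((hqh.rename_isHomogeneous).sub (tau_hom hqh))) ?_ ?_
  · intro P hP
    rw [map_add, corr_hyp hqh, hq1, (mem_vanish_iff hqh _).mp hq P hP, map_pow, eval_X]
    have : (1 : Fin (k + 3)) = Fin.succ 0 := rfl
    rw [this, Fin.cons_succ]; ring
  · intro i
    rw [map_add, corr_line, map_pow, eval_X, lv_apply_one, add_zero]

lemma soc_beta [CharZero K] {k β v : ℕ} (Γ₀ : Finset (Projectivization K (Fin (k + 2) → K)))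
    (hv : vanishingIdeal (Γ₀ : Set (Projectivization K (Fin (k + 2) → K))) ⊔
      Ideal.span {f | ∃ i : Fin (k + 2), 1 ≤ (i : ℕ) ∧ f = X i} =
      Ideal.span ({X (0 : Fin (k + 2)) ^ v} ∪ {f | ∃ i : Fin (k + 2), 1 ≤ (i : ℕ) ∧ f = X i}))
    (u : Fin β → K) (hu : Function.Injective u) (h1 : 1 ≤ β) (h2 : β ≤ v) :
    Soc (vanishingIdeal ((MigGamma Γ₀ u) : Set (Projectivization K (Fin (k + 3) → K)))) β := by
  have hX : (X 1 ^ β : MvPolynomial (Fin (k + 3)) K).IsHomogeneous β := by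
    simpa using (isHomogeneous_X K (1 : Fin (k + 3))).pow β
  have hp : (∏ i : Fin β, (X 1 - C (u i) * X 0) : MvPolynomial (Fin (k + 3)) K).IsHomogeneous β := by
    have := IsHomogeneous.prod (Finset.univ : Finset (Fin β))
      (fun i => (X 1 - C (u i) * X 0 : MvPolynomial (Fin (k + 3)) K)) (fun _ => 1) (by
        intro i _
        refine (isHomogeneous_X _ _).sub ?_
        simpa using (isHomogeneous_C (Fin (k + 3)) (u i)).mul (isHomogeneous_X K (0 : Fin (k + 3))))
    simpa using this
  refine soc_upper Γ₀ hv u hu h1 h2 le_rfl (X 1 ^ β - ∏ i : Fin β, (X 1 - C (u i) * X 0))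
    (hX.sub hp) ?_ ?_
  · intro P hP
    simp
  · intro i
    rw [map_sub, map_pow, eval_X, lv_apply_one, map_prod, Finset.prod_eq_zero (Finset.mem_univ i),
      sub_zero]
    simp [lv_apply_one, lv_apply_zero]

lemma soc_lower [CharZero K] {k α β s d : ℕ} (Γ₀ : Finset (Projectivization K (Fin (k + 2) → K)))
    (hgen : ∀ i, HF (vanishingIdeal (Γ₀ : Set (Projectivization K (Fin (k + 2) → K)))) i =
      min ((i + (k + 2) - 1).choose (k + 2 - 1)) α)
    (hsmin : ∀ j, α < (j + (k + 2) - 1).choose (k + 2 - 1) → s ≤ j)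
    (u : Fin β → K) (hu : Function.Injective u) (hdβ : d < β) (hds : d + 1 < s) :
    ¬ Soc (vanishingIdeal ((MigGamma Γ₀ u) : Set (Projectivization K (Fin (k + 3) → K)))) d := by
  rintro ⟨g, hg, hgI, hnot⟩
  apply hnot
  have hh : ∀ i j, (X i * g j - X j * g i).IsHomogeneous (1 + d) := fun i j =>
    ((isHomogeneous_X _ _).mul (hg j)).sub ((isHomogeneous_X _ _).mul (hg i))
  have hgM := fun i j => (mem_Mig_iff (hh i j) Γ₀ u).mp (hgI i j)
  have hz : ∀ i j, rho K (k + 2) (X i * g j - X j * g i) = 0 := by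
    intro i j
    refine J_zero (by omega) _ hgen hsmin (by omega : 1 + d < s) (rho_hom (hh i j)) ?_
    rw [mem_vanish_iff (rho_hom (hh i j))]
    intro P hP
    rw [eval_rho]
    exact (hgM i j).1 P hP
  have h0 : rho K (k + 2) (g 0) = 0 := by
    have := hz (Fin.succ 0) 0
    rw [map_sub, map_mul, map_mul, rho_X_zero, rho_X_succ, zero_mul, sub_zero] at this
    exact (mul_eq_zero.mp this).resolve_left (X_ne_zero _)
  obtain ⟨H, hH⟩ := X_zero_dvd h0
  have hHG : GH H 1 d := hom_of_X_mul (i := 0) (hH ▸ hg 0)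
  have hs : ∀ i j : Fin (k + 2),
      X i * rho K (k + 2) (g j.succ) = X j * rho K (k + 2) (g i.succ) := by
    intro i j
    have := hz i.succ j.succ
    rw [map_sub, map_mul, map_mul, rho_X_succ, rho_X_succ] at this
    exact sub_eq_zero.mp this
  have hdvd : (X 0 : MvPolynomial (Fin (k + 2)) K) ∣ rho K (k + 2) (g (Fin.succ 0)) := by
    have h1 : (X 0 : MvPolynomial (Fin (k + 2)) K) ∣ X 1 * rho K (k + 2) (g (Fin.succ 0)) :=
      ⟨_, (hs 0 1).symm⟩
    refine ((X_prime (R := K) (i := (0 : Fin (k + 2)))).dvd_or_dvd h1).resolve_left ?_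
    rw [X_dvd_X]
    simp
  obtain ⟨h, hh1⟩ := hdvd
  have hhj : ∀ j : Fin (k + 2), rho K (k + 2) (g j.succ) = X j * h := by
    intro j
    have h1 := hs 0 j
    rw [hh1] at h1
    refine mul_left_cancel₀ (X_ne_zero (R := K) (0 : Fin (k + 2))) ?_
    rw [h1]; ring
  have hhG : GH h 1 d := hom_of_X_mul (i := 0) (hh1 ▸ rho_hom (hg (Fin.succ 0)))
  -- values on the line
  have hline : ∀ i j, eval (lv (k + 2) 1 (u i)) (g j) =
      lv (k + 2) 1 (u i) j * eval (lv (k + 2) 1 (u i)) H := by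
    intro i j
    have h1 := (hgM 0 j).2 i
    rw [map_sub, map_mul, map_mul, eval_X, eval_X, lv_apply_zero, hH, map_mul, eval_X,
      lv_apply_zero] at h1
    linear_combination h1
  have hpt : eval (Pi.single 0 1) h = eval (Pi.single 0 1) (rho K (k + 2) H) := by
    have hl := line_lemma ((hg 1).sub (GH_mul hHG 1)) hdβ u hu (by
      intro i
      rw [map_sub, hline, map_mul, eval_X, sub_self]) 0 1
    rw [map_sub, map_mul, eval_X, lv_apply_one, lv_zero_one, ← eval_rho, ← eval_rho] at hl
    have h2 : (1 : Fin (k + 3)) = Fin.succ 0 := rfl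
    rw [h2, hhj, map_mul, eval_X] at hl
    simp only [Pi.single_eq_same] at hl
    linear_combination hl
  have hHh := GH_pred hHG
  have hhh := GH_pred hhG
  let e := h - rho K (k + 2) H
  have heh : e.IsHomogeneous (d - 1) := hhh.sub (rho_hom hHh)
  have he0 : eval (Pi.single 0 1) e = 0 := by
    simp only [e, map_sub]; rw [hpt, sub_self]
  let H' := H + (rename Fin.succ e - tau K k e)
  have hH' : GH H' 1 d := by
    rcases Nat.eq_zero_or_pos d with rfl | hd
    · left
      simp only [H', e]
      rw [GH_zero hHG, GH_zero hhG]; simp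
    · right
      exact ⟨d - 1, hHh.add (heh.rename_isHomogeneous.sub (tau_hom heh)), by omega⟩
  refine ⟨H', hH', fun j => ?_⟩
  rw [mem_Mig_iff ((hg j).sub (GH_mul hH' j))]
  constructor
  · intro P hP
    rw [map_sub, map_mul, eval_X]
    have h1 : eval (Fin.cons 0 P.rep) H' = eval P.rep h := by
      simp only [H']
      rw [map_add, corr_hyp heh, he0, ← eval_rho]
      simp only [e, map_sub]; ring
    rw [h1, ← eval_rho]
    refine Fin.cases ?_ (fun i => ?_) j
    · rw [h0]; simp
    · rw [hhj, map_mul, eval_X, Fin.cons_succ, sub_self]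
  · intro i
    have h1 : eval (lv (k + 2) 1 (u i)) H' = eval (lv (k + 2) 1 (u i)) H := by
      simp only [H']
      rw [map_add, corr_line, add_zero]
    rw [map_sub, map_mul, eval_X, h1, hline, sub_self]

lemma card_Mig {k β : ℕ} (Γ₀ : Finset (Projectivization K (Fin (k + 2) → K)))
    (u : Fin β → K) (hu : Function.Injective u) : (MigGamma Γ₀ u).card = Γ₀.card + β := by
  classical
  have h1 : Function.Injective (embedPt (K := K) (m := k + 2)) := by
    intro P Q h
    obtain ⟨a, ha⟩ := (Projectivization.mk_eq_mk_iff' K _ _ _ _).mp h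
    rw [← P.mk_rep, ← Q.mk_rep, Projectivization.mk_eq_mk_iff']
    refine ⟨a, ?_⟩
    funext i
    simpa using congrFun ha i.succ
  have h2 : Function.Injective (fun i => linePt (k + 2) (u i)) := by
    intro i j h
    obtain ⟨a, ha⟩ := (Projectivization.mk_eq_mk_iff' K _ _ _ _).mp h
    have h0 := congrFun ha 0
    have h1 := congrFun ha 1
    simp at h0 h1
    rw [h0, one_mul] at h1
    exact (hu h1).symm
  have h3 : Disjoint (Γ₀.image embedPt) (Finset.univ.image (fun i => linePt (k + 2) (u i))) := by
    rw [Finset.disjoint_left]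
    intro P hP hQ
    obtain ⟨Q, -, rfl⟩ := Finset.mem_image.mp hP
    obtain ⟨i, -, h⟩ := Finset.mem_image.mp hQ
    obtain ⟨a, ha⟩ := (Projectivization.mk_eq_mk_iff' K _ _ _ _).mp h
    have h0 := congrFun ha 0
    simp at h0
  have h4 : MigGamma Γ₀ u = Γ₀.image embedPt ∪ Finset.univ.image (fun i => linePt (k + 2) (u i)) := by
    unfold MigGamma
    congr!
  rw [h4, Finset.card_union_of_disjoint h3, Finset.card_image_of_injective _ h1,
    Finset.card_image_of_injective _ h2, Finset.card_univ, Fintype.card_fin]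

lemma aMin_le {N e : ℕ} {I : Ideal (MvPolynomial (Fin N) K)} (res : MinFreeRes N K I) {l : ℕ}
    (hl : res.len = l) (h : ∃ i, res.twist l i = e) : res.aMin ≤ e := by
  subst hl
  obtain ⟨i, rfl⟩ := h
  exact Finset.inf'_le _ (Finset.mem_univ i)

lemma aMin_mem {N : ℕ} {I : Ideal (MvPolynomial (Fin N) K)} (res : MinFreeRes N K I) {l : ℕ}
    (hl : res.len = l) : ∃ i, res.twist l i = res.aMin := by
  subst hl
  obtain ⟨i, -, hi⟩ := Finset.exists_mem_eq_inf'
    (Finset.univ_nonempty_iff.mpr (Fin.pos_iff_nonempty.mp res.rk_len_pos))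
    (fun i => res.twist res.len i)
  exact ⟨i, hi.symm⟩

end Final

/-- (Main theorem of Section 3.) For `Γ = Γ₁ ∪ Γ₂` as in the
Migliore construction with `α ≥ β + n - 2`:
(1) if `α < C(β+n-3, n-1)` then `d(Γ) > A_n`;
(2) if `α ≥ C(β+n, n-1)` then `d(Γ) = A_n`. -/
theorem migliore_main
    {K : Type} [Field K] [CharZero K] {n α β : ℕ} (hn : 2 ≤ n)
    (hα : 0 < α) (hβ : 0 < β)
    (Γ₀ : Finset (Projectivization K (Fin n → K)))
    (hcard : Γ₀.card = α)
    (hgen : ∀ i, HF (vanishingIdeal (Γ₀ : Set (Projectivization K (Fin n → K)))) i =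
      min ((i + n - 1).choose (n - 1)) α)
    (u : Fin β → K) (hu : Function.Injective u)
    (s : ℕ) (hs : α < (s + n - 1).choose (n - 1))
    (hsmin : ∀ j, α < (j + n - 1).choose (n - 1) → s ≤ j)
    (v : ℕ) (hvs : v = s ∨ v = s + 1)
    (hv : vanishingIdeal (Γ₀ : Set (Projectivization K (Fin n → K))) ⊔
        Ideal.span {f | ∃ i : Fin n, 1 ≤ (i : ℕ) ∧ f = X i} =
      Ideal.span ({X (⟨0, by omega⟩ : Fin n) ^ v} ∪ {f | ∃ i : Fin n, 1 ≤ (i : ℕ) ∧ f = X i}))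
    (hαβ : β + n - 2 ≤ α)
    (hhyp : hyp (MigGamma Γ₀ u) = α)
    (res : MinFreeRes (n + 1) K
      (vanishingIdeal ((MigGamma Γ₀ u) : Set (Projectivization K (Fin (n + 1) → K)))))
    (hlen : res.len = n) :
    (α < (β + n - 3).choose (n - 1) → res.A < (minDist (MigGamma Γ₀ u) : ℤ)) ∧
    ((β + n).choose (n - 1) ≤ α → (minDist (MigGamma Γ₀ u) : ℤ) = res.A) := by
  obtain ⟨k, rfl⟩ : ∃ k, n = k + 2 := ⟨n - 2, by omega⟩
  have hdist : minDist (MigGamma Γ₀ u) = β := by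
    unfold minDist
    rw [hhyp, card_Mig Γ₀ u hu, hcard]; omega
  rw [hdist]
  have hs1 : 1 ≤ s := by
    rcases Nat.eq_zero_or_pos s with rfl | h
    · rw [Nat.zero_add, Nat.choose_self] at hs; omega
    · exact h
  have hA : res.A = (res.aMin : ℤ) - ((k + 2 : ℕ) : ℤ) := by
    unfold MinFreeRes.A; rw [hlen]
  have htw := twist_iff_soc (m := k + 1) res hlen
  constructor
  · intro h
    have hβ3 : 2 ≤ β := by
      by_contra hlt
      have : (β + (k + 2) - 3).choose (k + 2 - 1) = 0 := Nat.choose_eq_zero_of_lt (by omega)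
      omega
    have hsβ : s ≤ β - 2 := by
      apply hsmin
      have : β - 2 + (k + 2) - 1 = β + (k + 2) - 3 := by omega
      rwa [this]
    have hsoc := soc_v Γ₀ hv u hu (by omega) (by omega)
    have := aMin_le res hlen ((htw (v + (k + 1 + 1))).mpr ⟨v, rfl, hsoc⟩)
    rw [hA]
    push_cast
    omega
  · intro h
    have hsβ : β + 2 ≤ s := by
      by_contra hlt
      have : (s + (k + 2) - 1).choose (k + 2 - 1) ≤ (β + (k + 2)).choose (k + 2 - 1) :=
        Nat.choose_le_choose _ (by omega)
      omega
    have hsoc := soc_beta Γ₀ hv u hu (by omega) (by omega)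
    have h1 := aMin_le res hlen ((htw (β + (k + 1 + 1))).mpr ⟨β, rfl, hsoc⟩)
    obtain ⟨d, hd, hdS⟩ := (htw res.aMin).mp (aMin_mem res hlen)
    have h2 : β ≤ d := by
      by_contra hlt
      exact soc_lower Γ₀ hgen hsmin u hu (by omega) (by omega) hdS
    rw [hA]
    push_cast
    omega

end PointsMinDist
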